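/- arXiv:1203.6336 — 2 statements merged into one kernel-verified Lean document; each statement's English description precedes it below -/
import Mathlib

section
/- (Classification of double-light-cone media into three metaclasses.) Suppose κ is a skewon-free invertible medium tensor on ℝ⁴, with 6×6 matrix M, whose Fresnel polynomial has zero set equal to the union of two distinct Lorentz null cones. Then there exists P ∈ GL(4,ℝ) such that sgn(det P)·T(P) M T(P)⁻¹ is given by exactly one of the following three normal forms: (Metaclass I) the block matrix [[D_α, −D_β],[D_β, D_α]] with D_α = diag(α₁,α₂,α₂), D_β = diag(β₁,β₂,β₂), where β₁, β₂ ≠ 0, sgn β₁ = sgn β₂, and α₁ ≠ α₂ or β₁ ≠ β₂; (Metaclass II) the matrix with rows (α₁,−β₁,0,0,0,0), (β₁,α₁,0,0,0,0), (0,0,α₁,0,0,−β₁), (0,1,0,α₁,β₁,0), (1,0,0,−β₁,α₁,0), (0,0,β₁,0,0,α₁), where β₁ ≠ 0; (Metaclass IV) the matrix with rows (α₁,0,0,−β₁,0,0), (0,α₁,0,0,−β₁,0), (0,0,α₃,0,0,α₄), (β₁,0,0,α₁,0,0), (0,β₁,0,0,α₁,0), (0,0,α₄,0,0,α₃), where β₁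 ≠ 0, α₄ ≠ 0 and α₃² ≠ α₄². Conversely, the Fresnel polynomial of each of these three normal forms has zero set equal to the union of two distinct Lorentz null cones. -/
noncomputable section
open Matrix BigOperators

/-- Medium tensor components `κ^{ij}_{rs}` on ℝ⁴ (upper indices first). -/
abbrev MT := Fin 4 → Fin 4 → Fin 4 → Fin 4 → ℝ

/-- Bivector (or 2-form) components on ℝ⁴. -/
abbrev BV := Fin 4 → Fin 4 → ℝ

/-- Totally antisymmetric Levi-Civita symbol on {0,1,2,3} with ε₀₁₂₃ = 1. -/
def eps (i j k l : Fin 4) : ℝ :=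
  ((j.val : ℝ) - i.val) * ((k.val : ℝ) - i.val) * ((l.val : ℝ) - i.val) *
    ((k.val : ℝ) - j.val) * ((l.val : ℝ) - j.val) * ((l.val : ℝ) - k.val) / 12

/-- Identity medium tensor `Id^{ij}_{rs} = δ^i_r δ^j_s − δ^i_s δ^j_r`. -/
def idT : MT := fun i j r s =>
  (if i = r then (1 : ℝ) else 0) * (if j = s then 1 else 0) -
    (if i = s then 1 else 0) * (if j = r then 1 else 0)

/-- Composition `(κ∘η)^{ij}_{rs} = (1/2) κ^{ab}_{rs} η^{ij}_{ab}`. -/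
def compT (κ η : MT) : MT := fun i j r s => (1 / 2) * ∑ a, ∑ b, κ a b r s * η i j a b

/-- Poincaré adjoint `κ̄^{ij}_{rs} = (1/4) ε_{rsab} κ^{ab}_{cd} ε^{cdij}`. -/
def adjT (κ : MT) : MT := fun i j r s =>
  (1 / 4) * ∑ a, ∑ b, ∑ c, ∑ d, eps r s a b * κ a b c d * eps c d i j

/-- Trace `tr κ = (1/2) κ^{ij}_{ij}`. -/
def traceT (κ : MT) : ℝ := (1 / 2) * ∑ i, ∑ j, κ i j i j

def antisymBV (A : BV) : Prop := ∀ i j, A i j = - A j i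

def antisymMT (κ : MT) : Prop :=
  (∀ i j r s, κ i j r s = - κ j i r s) ∧ (∀ i j r s, κ i j r s = - κ i j s r)

/-- The medium tensor `(ρ Ā⊗B)^{ij}_{rs} = ρ ε_{rsab} A^{ab} B^{ij}`. -/
def tensAB (ρ : ℝ) (A B : BV) : MT := fun i j r s =>
  ρ * (∑ a, ∑ b, eps r s a b * A a b) * B i j

/-- Hodge star `(∗_g)^{ij}_{rs} = √|det g| g^{ia} g^{jb} ε_{abrs}`. -/
def hodge (g : Matrix (Fin 4) (Fin 4) ℝ) : MT := fun i j r s =>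
  Real.sqrt |g.det| * ∑ a, ∑ b, g⁻¹ i a * g⁻¹ j b * eps a b r s

/-- The (non-symmetrised) Fresnel tensor density `𝒢₀^{ijkl}`. -/
def G0 (κ : MT) (i j k l : Fin 4) : ℝ :=
  (1 / 48) * ∑ a₁, ∑ a₂, ∑ a₃, ∑ a₄, ∑ b₁, ∑ b₂, ∑ b₃, ∑ b₄, ∑ b₅, ∑ b₆,
    κ a₁ a₂ b₁ b₂ * κ a₃ i b₃ b₄ * κ a₄ j b₅ b₆ *
      eps b₁ b₂ b₅ k * eps b₃ b₄ b₆ l * eps a₁ a₂ a₃ a₄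

/-- Fresnel polynomial `G(ξ) = 𝒢₀^{ijkl} ξ_i ξ_j ξ_k ξ_l`. -/
def fresnel (κ : MT) (ξ : Fin 4 → ℝ) : ℝ :=
  ∑ i, ∑ j, ∑ k, ∑ l, G0 κ i j k l * ξ i * ξ j * ξ k * ξ l

/-- A Lorentz metric: real symmetric invertible 4×4 matrix of signature
(−+++) or (+−−−), equivalently symmetric with negative determinant. -/
def IsLorentz (g : Matrix (Fin 4) (Fin 4) ℝ) : Prop := g.IsSymm ∧ g.det < 0

/-- Null cone `N(g) = {ξ : g^{ij} ξ_i ξ_j = 0}` (on covectors, via the inverse metric). -/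
def nullCone (g : Matrix (Fin 4) (Fin 4) ℝ) : Set (Fin 4 → ℝ) :=
  {ξ | ∑ i, ∑ j, g⁻¹ i j * ξ i * ξ j = 0}

/-- The ordering O = (01, 02, 03, 23, 31, 12) of index pairs. -/
def pairs : Fin 6 → Fin 4 × Fin 4 := ![(0, 1), (0, 2), (0, 3), (2, 3), (3, 1), (1, 2)]

/-- The 6×6 matrix representing a medium tensor: `M_{IJ} = κ^{J₁J₂}_{I₁I₂}`. -/
def mat6 (κ : MT) : Matrix (Fin 6) (Fin 6) ℝ := fun I J =>
  κ (pairs J).1 (pairs J).2 (pairs I).1 (pairs I).2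

/-- The Fresnel surface decomposes into a double light cone. -/
def DoubleCone (κ : MT) : Prop :=
  ∃ gp gm, IsLorentz gp ∧ IsLorentz gm ∧ nullCone gp ≠ nullCone gm ∧
    {ξ | fresnel κ ξ = 0} = nullCone gp ∪ nullCone gm

/-- Second compound matrix T(P) acting on 2-form components in the basis O. -/
def compound (P : Matrix (Fin 4) (Fin 4) ℝ) : Matrix (Fin 6) (Fin 6) ℝ := fun I J =>
  P (pairs I).1 (pairs J).1 * P (pairs I).2 (pairs J).2 -
    P (pairs I).1 (pairs J).2 * P (pairs I).2 (pairs J).1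

/-- The basis 2-form (bivector) indexed by I ∈ O, as antisymmetric components. -/
def bform (I : Fin 6) : BV := fun i j =>
  if (i, j) = pairs I then 1 else if (j, i) = pairs I then -1 else 0

/-- The medium tensor determined by a 6×6 matrix M (so that mat6 ∘ tensorOf = id). -/
def tensorOf (M : Matrix (Fin 6) (Fin 6) ℝ) : MT := fun i j r s =>
  ∑ I, ∑ J, M I J * bform J i j * bform I r s

/-- Metaclass I normal form: [[D_α, −D_β],[D_β, D_α]] with D_α = diag(α₁,α₂,α₂),
D_β = diag(β₁,β₂,β₂), β₁β₂ > 0 (both nonzero, equal signs), and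
α₁ ≠ α₂ or β₁ ≠ β₂. -/
def MetaI (R : Matrix (Fin 6) (Fin 6) ℝ) : Prop :=
  ∃ α₁ α₂ β₁ β₂ : ℝ, β₁ ≠ 0 ∧ β₂ ≠ 0 ∧ 0 < β₁ * β₂ ∧ (α₁ ≠ α₂ ∨ β₁ ≠ β₂) ∧
    R = !![α₁, 0, 0, -β₁, 0, 0;
           0, α₂, 0, 0, -β₂, 0;
           0, 0, α₂, 0, 0, -β₂;
           β₁, 0, 0, α₁, 0, 0;
           0, β₂, 0, 0, α₂, 0;
           0, 0, β₂, 0, 0, α₂]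

/-- Metaclass II normal form. -/
def MetaII (R : Matrix (Fin 6) (Fin 6) ℝ) : Prop :=
  ∃ α₁ β₁ : ℝ, β₁ ≠ 0 ∧
    R = !![α₁, -β₁, 0, 0, 0, 0;
           β₁, α₁, 0, 0, 0, 0;
           0, 0, α₁, 0, 0, -β₁;
           0, 1, 0, α₁, β₁, 0;
           1, 0, 0, -β₁, α₁, 0;
           0, 0, β₁, 0, 0, α₁]

/-- Metaclass IV normal form. -/
def MetaIV (R : Matrix (Fin 6) (Fin 6) ℝ) : Prop :=
  ∃ α₁ α₃ α₄ β₁ : ℝ, β₁ ≠ 0 ∧ α₄ ≠ 0 ∧ α₃ ^ 2 ≠ α₄ ^ 2 ∧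
    R = !![α₁, 0, 0, -β₁, 0, 0;
           0, α₁, 0, 0, -β₁, 0;
           0, 0, α₃, 0, 0, α₄;
           β₁, 0, 0, α₁, 0, 0;
           0, β₁, 0, 0, α₁, 0;
           0, 0, α₄, 0, 0, α₃]

/-- M can be brought by the (twisted) change of coordinates P to a matrix in
the given class. -/
def InClass (M : Matrix (Fin 6) (Fin 6) ℝ)
    (C : Matrix (Fin 6) (Fin 6) ℝ → Prop) : Prop :=
  ∃ P : Matrix (Fin 4) (Fin 4) ℝ, IsUnit P.det ∧
    C (Real.sign P.det • (compound P * M * (compound P)⁻¹))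

/-- The first factor of the Fresnel polynomial. -/
def fresnelLeft (κ : MT) (ξ : Fin 4 → ℝ) (a₁ a₂ b : Fin 4) : ℝ :=
  ∑ b₁, ∑ b₂, ∑ k, κ a₁ a₂ b₁ b₂ * eps b₁ b₂ b k * ξ k

/-- The second factor of the Fresnel polynomial, contracted with `ξ`. -/
def fresnelMid (κ : MT) (ξ : Fin 4 → ℝ) (a b : Fin 4) : ℝ :=
  ∑ i, ∑ b₁, ∑ b₂, ∑ l, κ a i b₁ b₂ * ξ i * eps b₁ b₂ b l * ξ l

/-- The third factor of the Fresnel polynomial, contracted with `ξ`. -/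
def fresnelRight (κ : MT) (ξ : Fin 4 → ℝ) (a b₁ b₂ : Fin 4) : ℝ :=
  ∑ j, κ a j b₁ b₂ * ξ j

theorem sum_sum_comm₄ {ι : Type*} [Fintype ι] (F : ι → ι → ι → ι → ι → ι → ι → ι → ι → ι → ℝ) :
    ∑ i, ∑ j, ∑ k, ∑ l, ∑ b₁, ∑ b₂, ∑ b₃, ∑ b₄, ∑ b₅, ∑ b₆, F i j k l b₁ b₂ b₃ b₄ b₅ b₆ =
      ∑ b₅, ∑ b₆, ∑ b₁, ∑ b₂, ∑ k, ∑ i, ∑ b₃, ∑ b₄, ∑ l, ∑ j, F i j k l b₁ b₂ b₃ b₄ b₅ b₆ := by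
  let e : (ι × ι × ι × ι × ι × ι × ι × ι × ι × ι) ≃ (ι × ι × ι × ι × ι × ι × ι × ι × ι × ι) :=
    { toFun := fun ⟨i, j, k, l, b₁, b₂, b₃, b₄, b₅, b₆⟩ => ⟨b₅, b₆, b₁, b₂, k, i, b₃, b₄, l, j⟩
      invFun := fun ⟨b₅, b₆, b₁, b₂, k, i, b₃, b₄, l, j⟩ => ⟨i, j, k, l, b₁, b₂, b₃, b₄, b₅, b₆⟩
      left_inv := fun _ => rfl
      right_inv := fun _ => rfl }
  have h := e.symm.sum_comp fun p : ι × ι × ι × ι × ι × ι × ι × ι × ι × ι =>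
    F p.1 p.2.1 p.2.2.1 p.2.2.2.1 p.2.2.2.2.1 p.2.2.2.2.2.1 p.2.2.2.2.2.2.1 p.2.2.2.2.2.2.2.1
      p.2.2.2.2.2.2.2.2.1 p.2.2.2.2.2.2.2.2.2
  simp only [Fintype.sum_prod_type] at h
  exact h.symm

theorem sum_mul_sum_mul_sum {ι : Type*} [Fintype ι] (f : ι → ι → ι → ℝ) (g : ι → ι → ι → ι → ℝ)
    (h : ι → ℝ) :
    (∑ x, ∑ y, ∑ z, f x y z) * (∑ x, ∑ y, ∑ z, ∑ w, g x y z w) * (∑ x, h x) =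
      ∑ b₁, ∑ b₂, ∑ k, ∑ i, ∑ b₃, ∑ b₄, ∑ l, ∑ j, f b₁ b₂ k * g i b₃ b₄ l * h j := by
  have h₁ (G H : ℝ) : (∑ x, ∑ y, ∑ z, f x y z) * G * H = ∑ x, ∑ y, ∑ z, f x y z * G * H := by
    simp only [Finset.sum_mul]
  have h₂ (c H : ℝ) : c * (∑ x, ∑ y, ∑ z, ∑ w, g x y z w) * H =
      ∑ x, ∑ y, ∑ z, ∑ w, c * g x y z w * H := by
    simp only [Finset.mul_sum, Finset.sum_mul]
  rw [h₁]
  refine Finset.sum_congr rfl fun _ _ => Finset.sum_congr rfl fun _ _ =>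
    Finset.sum_congr rfl fun _ _ => ?_
  rw [h₂]
  simp only [Finset.mul_sum]

theorem mul_sum₆_mul {ι : Type*} [Fintype ι] (c d : ℝ) (f : ι → ι → ι → ι → ι → ι → ℝ) :
    c * (∑ b₁, ∑ b₂, ∑ b₃, ∑ b₄, ∑ b₅, ∑ b₆, f b₁ b₂ b₃ b₄ b₅ b₆) * d =
      ∑ b₁, ∑ b₂, ∑ b₃, ∑ b₄, ∑ b₅, ∑ b₆, c * f b₁ b₂ b₃ b₄ b₅ b₆ * d := by
  simp only [Finset.sum_mul, Finset.mul_sum]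

theorem sum_sum_comm₄₄ {ι : Type*} [Fintype ι] (F : ι → ι → ι → ι → ι → ι → ι → ι → ℝ) :
    ∑ i, ∑ j, ∑ k, ∑ l, ∑ a₁, ∑ a₂, ∑ a₃, ∑ a₄, F i j k l a₁ a₂ a₃ a₄ =
      ∑ a₁, ∑ a₂, ∑ a₃, ∑ a₄, ∑ i, ∑ j, ∑ k, ∑ l, F i j k l a₁ a₂ a₃ a₄ := by
  have h := Finset.sum_comm (s := (Finset.univ : Finset (ι × ι × ι × ι)))
    (t := (Finset.univ : Finset (ι × ι × ι × ι)))
    (f := fun p q => F p.1 p.2.1 p.2.2.1 p.2.2.2 q.1 q.2.1 q.2.2.1 q.2.2.2)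
  simpa only [Fintype.sum_prod_type] using h

theorem mul_sum₄_mul {ι : Type*} [Fintype ι] (c d₁ d₂ d₃ d₄ : ℝ) (f : ι → ι → ι → ι → ℝ) :
    c * (∑ a₁, ∑ a₂, ∑ a₃, ∑ a₄, f a₁ a₂ a₃ a₄) * d₁ * d₂ * d₃ * d₄ =
      ∑ a₁, ∑ a₂, ∑ a₃, ∑ a₄, c * f a₁ a₂ a₃ a₄ * (d₁ * d₂ * d₃ * d₄) := by
  simp only [mul_assoc, Finset.sum_mul, Finset.mul_sum]

theorem mul_sum₂ {ι : Type*} [Fintype ι] (c : ℝ) (f : ι → ι → ℝ) :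
    c * (∑ x, ∑ y, f x y) = ∑ x, ∑ y, c * f x y := by
  simp only [Finset.mul_sum]

theorem mul_sum₈ {ι : Type*} [Fintype ι] (c : ℝ) (f : ι → ι → ι → ι → ι → ι → ι → ι → ℝ) :
    c * (∑ x, ∑ y, ∑ z, ∑ w, ∑ p, ∑ q, ∑ r, ∑ s, f x y z w p q r s) =
      ∑ x, ∑ y, ∑ z, ∑ w, ∑ p, ∑ q, ∑ r, ∑ s, c * f x y z w p q r s := by
  simp only [Finset.mul_sum]

theorem fresnel_eq_sum (κ : MT) (ξ : Fin 4 → ℝ) :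
    fresnel κ ξ = ∑ a₁, ∑ a₂, ∑ a₃, ∑ a₄, (1 / 48) * eps a₁ a₂ a₃ a₄ * ∑ b₅, ∑ b₆,
      fresnelLeft κ ξ a₁ a₂ b₅ * fresnelMid κ ξ a₃ b₆ * fresnelRight κ ξ a₄ b₅ b₆ := by
  have h : fresnel κ ξ = ∑ i, ∑ j, ∑ k, ∑ l, ∑ a₁, ∑ a₂, ∑ a₃, ∑ a₄, ∑ b₁, ∑ b₂, ∑ b₃, ∑ b₄,
      ∑ b₅, ∑ b₆, 1 / 48 * (κ a₁ a₂ b₁ b₂ * κ a₃ i b₃ b₄ * κ a₄ j b₅ b₆ *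
      eps b₁ b₂ b₅ k * eps b₃ b₄ b₆ l * eps a₁ a₂ a₃ a₄) * (ξ i * ξ j * ξ k * ξ l) := by
    refine Finset.sum_congr rfl fun i _ => Finset.sum_congr rfl fun j _ =>
      Finset.sum_congr rfl fun k _ => Finset.sum_congr rfl fun l _ => ?_
    rw [G0, mul_sum₄_mul]
    refine Finset.sum_congr rfl fun a₁ _ => Finset.sum_congr rfl fun a₂ _ =>
      Finset.sum_congr rfl fun a₃ _ => Finset.sum_congr rfl fun a₄ _ => ?_
    rw [mul_sum₆_mul]
  rw [h, sum_sum_comm₄₄]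
  refine Finset.sum_congr rfl fun a₁ _ => Finset.sum_congr rfl fun a₂ _ =>
    Finset.sum_congr rfl fun a₃ _ => Finset.sum_congr rfl fun a₄ _ => ?_
  rw [sum_sum_comm₄]
  rw [mul_sum₂]
  refine Finset.sum_congr rfl fun _ _ => Finset.sum_congr rfl fun _ _ => ?_
  rw [fresnelLeft, fresnelMid, fresnelRight, sum_mul_sum_mul_sum, mul_sum₈]
  repeat' refine Finset.sum_congr rfl fun _ _ => ?_
  ring

/-- Index of the complementary index pair. -/
def dual : Fin 6 → Fin 6 := ![3, 4, 5, 0, 1, 2]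

/-- The bilinear form `A` contracted with `e_b ∧ ξ` in its first slot. -/
def ctr (A : Matrix (Fin 6) (Fin 6) ℝ) (ξ : Fin 4 → ℝ) : Fin 4 → Fin 6 → ℝ :=
  ![fun J => A 0 J * ξ 1 + A 1 J * ξ 2 + A 2 J * ξ 3,
    fun J => -(A 0 J * ξ 0) + A 5 J * ξ 2 - A 4 J * ξ 3,
    fun J => -(A 1 J * ξ 0) - A 5 J * ξ 1 + A 3 J * ξ 3,
    fun J => -(A 2 J * ξ 0) + A 4 J * ξ 1 - A 3 J * ξ 2]

/-- A vector of bivector components as an antisymmetric array. -/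
def skew (w : Fin 6 → ℝ) : Fin 4 → Fin 4 → ℝ :=
  !![0, w 0, w 1, w 2; -w 0, 0, w 5, -w 4; -w 1, -w 5, 0, w 3; -w 2, w 4, -w 3, 0]

/-- The contraction of `A` with `e_b ∧ ξ` and `e_a ∧ ξ`. -/
def gramForm (A : Matrix (Fin 6) (Fin 6) ℝ) (ξ : Fin 4 → ℝ) (b : Fin 4) : Fin 4 → ℝ :=
  ![ctr A ξ b 0 * ξ 1 + ctr A ξ b 1 * ξ 2 + ctr A ξ b 2 * ξ 3,
    -(ctr A ξ b 0 * ξ 0) + ctr A ξ b 5 * ξ 2 - ctr A ξ b 4 * ξ 3,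
    -(ctr A ξ b 1 * ξ 0) - ctr A ξ b 5 * ξ 1 + ctr A ξ b 3 * ξ 3,
    -(ctr A ξ b 2 * ξ 0) + ctr A ξ b 4 * ξ 1 - ctr A ξ b 3 * ξ 2]

/-- The medium tensor with bilinear form `A`. -/
def medium (A : Matrix (Fin 6) (Fin 6) ℝ) : MT := fun i j r s =>
  skew (fun J => skew (fun I => A (dual I) J) r s) i j

/-- Explicit Fresnel polynomial of `medium A`. -/
def fres (A : Matrix (Fin 6) (Fin 6) ℝ) (ξ : Fin 4 → ℝ) : ℝ :=
  (1 / 6) * ∑ a, ∑ c, ∑ b, ∑ d, gramForm A ξ d a * skew (fun J => ctr A ξ b (dual J)) a c *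
    skew (fun J => ctr A ξ c (dual J)) b d

set_option maxHeartbeats 2000000 in
theorem eps_sum_skew (w : Fin 6 → ℝ) (b k : Fin 4) :
    ∑ b₁, ∑ b₂, skew w b₁ b₂ * eps b₁ b₂ b k = 2 * skew (fun J => w (dual J)) b k := by
  fin_cases b <;> fin_cases k <;>
  · simp [Fin.sum_univ_four, eps, skew, dual]; try norm_num; try ring

theorem skew_eq_sum (w : Fin 6 → ℝ) (i j : Fin 4) :
    skew w i j = ∑ I, w I * skew (Pi.single I 1) i j := by
  fin_cases i <;> fin_cases j <;> simp [skew, Pi.single_apply]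

theorem medium_eq (A : Matrix (Fin 6) (Fin 6) ℝ) (i j r s : Fin 4) :
    medium A i j r s = skew (fun I => skew (fun J => A (dual I) J) i j) r s := by
  rw [medium, skew_eq_sum, skew_eq_sum _ r s]
  simp only [skew_eq_sum (fun I => A (dual I) _), skew_eq_sum (fun J => A _ J), Finset.sum_mul]
  rw [Finset.sum_comm]
  exact Finset.sum_congr rfl fun _ _ => Finset.sum_congr rfl fun _ _ => by ring

theorem dual_dual (I : Fin 6) : dual (dual I) = I := by
  fin_cases I <;> rfl

theorem sum_skew_mul (A : Matrix (Fin 6) (Fin 6) ℝ) (ξ : Fin 4 → ℝ) (a₁ a₂ b : Fin 4) :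
    ∑ k, skew (fun I => skew (fun J => A I J) a₁ a₂) b k * ξ k = skew (ctr A ξ b) a₁ a₂ := by
  simp only [skew_eq_sum (fun J => A _ J), skew_eq_sum (ctr A ξ b)]
  fin_cases b <;> simp [Fin.sum_univ_four, Fin.sum_univ_six] <;>
    simp [skew.eq_1 (fun _ => _), ctr] <;> ring

theorem fresnelLeft_medium (A : Matrix (Fin 6) (Fin 6) ℝ) (ξ : Fin 4 → ℝ) (a₁ a₂ b : Fin 4) :
    fresnelLeft (medium A) ξ a₁ a₂ b = 2 * skew (ctr A ξ b) a₁ a₂ := by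
  have h : fresnelLeft (medium A) ξ a₁ a₂ b =
      ∑ k, (∑ b₁, ∑ b₂, medium A a₁ a₂ b₁ b₂ * eps b₁ b₂ b k) * ξ k := by
    simp only [fresnelLeft, Finset.sum_mul]
    rw [Finset.sum_comm]
    conv_rhs => rw [Finset.sum_comm]
    rw [Finset.sum_comm]
    exact Finset.sum_congr rfl fun _ _ => Finset.sum_comm
  simp only [h, medium_eq, eps_sum_skew, dual_dual, mul_assoc, ← Finset.mul_sum, sum_skew_mul]

theorem sum_skew_mul' (w : Fin 6 → ℝ) (ξ : Fin 4 → ℝ) (a : Fin 4) :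
    ∑ i, skew w a i * ξ i = ![w 0 * ξ 1 + w 1 * ξ 2 + w 2 * ξ 3,
    -(w 0 * ξ 0) + w 5 * ξ 2 - w 4 * ξ 3,
    -(w 1 * ξ 0) - w 5 * ξ 1 + w 3 * ξ 3,
    -(w 2 * ξ 0) + w 4 * ξ 1 - w 3 * ξ 2] a := by
  fin_cases a <;> simp [Fin.sum_univ_four, skew] <;> ring

theorem fresnelMid_medium (A : Matrix (Fin 6) (Fin 6) ℝ) (ξ : Fin 4 → ℝ) (a b : Fin 4) :
    fresnelMid (medium A) ξ a b = 2 * gramForm A ξ b a := by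
  have h : fresnelMid (medium A) ξ a b = ∑ i, fresnelLeft (medium A) ξ a i b * ξ i := by
    simp only [fresnelMid, fresnelLeft, Finset.sum_mul]
    repeat' refine Finset.sum_congr rfl fun _ _ => ?_
    ring
  simp only [h, fresnelLeft_medium, mul_assoc, ← Finset.mul_sum, sum_skew_mul', gramForm]

theorem fresnelRight_medium {A : Matrix (Fin 6) (Fin 6) ℝ} (hA : A.IsSymm) (ξ : Fin 4 → ℝ)
    (a b₁ b₂ : Fin 4) :
    fresnelRight (medium A) ξ a b₁ b₂ = skew (fun J => ctr A ξ a (dual J)) b₁ b₂ := by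
  have h : ∀ i j r s, medium A i j r s = skew (fun J => skew (fun I => A (dual J) I) i j) r s :=
    medium_eq A
  have h' : ∀ I J, A (dual I) J = A J (dual I) := fun I J => hA.apply _ _
  simp only [fresnelRight, medium, h']
  exact (sum_skew_mul (fun I J => A I (dual J)) ξ b₁ b₂ a).trans (by
    fin_cases a <;> rfl)

theorem eps_sum_skew' (w : Fin 6 → ℝ) (b k : Fin 4) :
    ∑ b₁, ∑ b₂, eps b₁ b₂ b k * skew w b₁ b₂ = 2 * skew (fun J => w (dual J)) b k := by
  simp only [← eps_sum_skew, mul_comm]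

theorem fresnel_medium {A : Matrix (Fin 6) (Fin 6) ℝ} (hA : A.IsSymm) (ξ : Fin 4 → ℝ) :
    fresnel (medium A) ξ = fres A ξ := by
  have h : fresnel (medium A) ξ = ∑ a₁, ∑ a₂, ∑ a₃, ∑ a₄, ∑ b₅, ∑ b₆,
      (eps a₁ a₂ a₃ a₄ * skew (ctr A ξ b₅) a₁ a₂) *
        ((1 / 12) * gramForm A ξ b₆ a₃ * skew (fun J => ctr A ξ a₄ (dual J)) b₅ b₆) := by
    rw [fresnel_eq_sum]
    simp only [fresnelLeft_medium, fresnelMid_medium, fresnelRight_medium hA, mul_sum₂]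
    repeat' refine Finset.sum_congr rfl fun _ _ => ?_
    ring
  have h' (F : Fin 4 → Fin 4 → Fin 4 → Fin 4 → Fin 4 → Fin 4 → ℝ) :
      ∑ a₁, ∑ a₂, ∑ a₃, ∑ a₄, ∑ b₅, ∑ b₆, F a₁ a₂ a₃ a₄ b₅ b₆ =
      ∑ a₃, ∑ a₄, ∑ b₅, ∑ b₆, ∑ a₁, ∑ a₂, F a₁ a₂ a₃ a₄ b₅ b₆ := by
    have := Finset.sum_comm (s := (Finset.univ : Finset (Fin 4 × Fin 4)))
      (t := (Finset.univ : Finset (Fin 4 × Fin 4 × Fin 4 × Fin 4)))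
      (f := fun p q => F p.1 p.2 q.1 q.2.1 q.2.2.1 q.2.2.2)
    simpa only [Fintype.sum_prod_type] using this
  rw [h, h', fres, Finset.mul_sum]
  refine Finset.sum_congr rfl fun a _ => ?_
  rw [Finset.mul_sum]
  refine Finset.sum_congr rfl fun c _ => ?_
  rw [mul_sum₂]
  refine Finset.sum_congr rfl fun b _ => Finset.sum_congr rfl fun d _ => ?_
  simp only [← Finset.sum_mul, eps_sum_skew']
  ring

set_option maxHeartbeats 4000000 in
theorem gramForm_minor {A : Matrix (Fin 6) (Fin 6) ℝ} (hA : A.IsSymm) (ξ : Fin 4 → ℝ) :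
    gramForm A ξ 1 1 * (gramForm A ξ 2 2 * gramForm A ξ 3 3 - gramForm A ξ 2 3 * gramForm A ξ 3 2) -
      gramForm A ξ 1 2 * (gramForm A ξ 2 1 * gramForm A ξ 3 3 - gramForm A ξ 2 3 * gramForm A ξ 3 1) +
      gramForm A ξ 1 3 * (gramForm A ξ 2 1 * gramForm A ξ 3 2 - gramForm A ξ 2 2 * gramForm A ξ 3 1) =
    ξ 0 ^ 2 * fres A ξ := by
  have h : ∀ I J, I < J → A J I = A I J := fun I J _ => hA.apply _ _
  simp only [fres, Fin.sum_univ_four]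
  simp [skew, dual]
  simp [gramForm, ctr]
  rw [h 0 1 (by decide), h 0 2 (by decide), h 0 3 (by decide), h 0 4 (by decide), h 0 5 (by decide),
    h 1 2 (by decide), h 1 3 (by decide), h 1 4 (by decide), h 1 5 (by decide), h 2 3 (by decide),
    h 2 4 (by decide), h 2 5 (by decide), h 3 4 (by decide), h 3 5 (by decide), h 4 5 (by decide)]
  ring

/-- The exterior product in the basis `O`. -/
def wedge (ξ η : Fin 4 → ℝ) : Fin 6 → ℝ :=
  ![ξ 0 * η 1 - ξ 1 * η 0, ξ 0 * η 2 - ξ 2 * η 0, ξ 0 * η 3 - ξ 3 * η 0,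
    ξ 2 * η 3 - ξ 3 * η 2, ξ 3 * η 1 - ξ 1 * η 3, ξ 1 * η 2 - ξ 2 * η 1]

/-- Gram matrix of `ξ ∧ η i` with respect to `A`. -/
def wedgeGram (A : Matrix (Fin 6) (Fin 6) ℝ) (ξ : Fin 4 → ℝ) (η : Fin 3 → Fin 4 → ℝ) :
    Matrix (Fin 3) (Fin 3) ℝ :=
  Matrix.of fun i j => wedge ξ (η i) ⬝ᵥ A *ᵥ wedge ξ (η j)

theorem wedgeGram_single (A : Matrix (Fin 6) (Fin 6) ℝ) (ξ : Fin 4 → ℝ) (i j : Fin 3) :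
    wedgeGram A ξ (fun k => Pi.single k.succ 1) i j = gramForm A ξ i.succ j.succ := by
  fin_cases i <;> fin_cases j <;>
    simp [wedgeGram, wedge, gramForm, ctr, dotProduct, mulVec, Fin.sum_univ_six] <;> ring

theorem smul_wedge (ξ η : Fin 4 → ℝ) :
    ξ 0 • wedge ξ η = ∑ k : Fin 3, (ξ 0 * η k.succ - η 0 * ξ k.succ) •
      wedge ξ (Pi.single k.succ 1) := by
  funext I
  fin_cases I <;> simp [wedge, Fin.sum_univ_three] <;> ring

theorem det_wedgeGram_aux (ξ : Fin 4 → ℝ) (η : Fin 3 → Fin 4 → ℝ) :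
    (Matrix.of fun i k : Fin 3 => ξ 0 * η i k.succ - η i 0 * ξ k.succ).det =
      ξ 0 ^ 2 * (Matrix.of (Fin.cons ξ η : Fin 4 → Fin 4 → ℝ)).det := by
  have h2 (j) : (Fin.cons ξ η : Fin 4 → Fin 4 → ℝ) 2 j = η 1 j := rfl
  have h3 (j) : (Fin.cons ξ η : Fin 4 → Fin 4 → ℝ) 3 j = η 2 j := rfl
  simp [det_succ_row_zero, Fin.sum_univ_succ, Fin.succAbove, h2, h3]
  ring

theorem det_wedgeGram_of_ne {A : Matrix (Fin 6) (Fin 6) ℝ} (hA : A.IsSymm) {ξ : Fin 4 → ℝ}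
    (hξ : ξ 0 ≠ 0) (η : Fin 3 → Fin 4 → ℝ) :
    (wedgeGram A ξ η).det =
      (Matrix.of (Fin.cons ξ η : Fin 4 → Fin 4 → ℝ)).det ^ 2 * fres A ξ := by
  set C := Matrix.of fun i k : Fin 3 => ξ 0 * η i k.succ - η i 0 * ξ k.succ with hC
  have h : ξ 0 ^ 2 • wedgeGram A ξ η =
      C * wedgeGram A ξ (fun k => Pi.single k.succ 1) * Cᵀ := by
    ext i j
    have : (ξ 0 ^ 2 • wedgeGram A ξ η) i j =
        (ξ 0 • wedge ξ (η i)) ⬝ᵥ A *ᵥ (ξ 0 • wedge ξ (η j)) := by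
      simp [wedgeGram, mulVec_smul]; ring
    rw [this, smul_wedge, smul_wedge]
    simp only [Matrix.mul_apply, sum_dotProduct, mulVec_sum, dotProduct_sum, smul_dotProduct,
      mulVec_smul, dotProduct_smul, Finset.sum_mul, transpose_apply, wedgeGram, of_apply, hC,
      smul_eq_mul]
    refine Finset.sum_congr rfl fun _ _ => ?_
    rw [Finset.mul_sum]
    exact Finset.sum_congr rfl fun _ _ => by ring
  have h' := congrArg Matrix.det h
  rw [det_mul, det_mul, det_transpose, det_smul, det_wedgeGram_aux, det_fin_three
    (wedgeGram A ξ fun k => Pi.single k.succ 1)] at h'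
  rw [wedgeGram_single, wedgeGram_single, wedgeGram_single, wedgeGram_single, wedgeGram_single,
    wedgeGram_single, wedgeGram_single, wedgeGram_single, wedgeGram_single] at h'
  have hm := gramForm_minor hA ξ
  simp only [Fintype.card_fin] at h'
  have e1 : Fin.succ (0 : Fin 3) = 1 := rfl
  have e2 : Fin.succ (1 : Fin 3) = 2 := rfl
  have e3 : Fin.succ (2 : Fin 3) = 3 := rfl
  rw [e1, e2, e3] at h'
  have h6 : (ξ 0) ^ 6 ≠ 0 := pow_ne_zero _ hξ
  apply mul_left_cancel₀ h6
  linear_combination h' + ξ 0 ^ 4 * (Matrix.of (Fin.cons ξ η : Fin 4 → Fin 4 → ℝ)).det ^ 2 * hm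

theorem continuous_wedge {X : Type*} [TopologicalSpace X] {f g : X → Fin 4 → ℝ}
    (hf : Continuous f) (hg : Continuous g) : Continuous fun x => wedge (f x) (g x) := by
  refine continuous_pi fun I => ?_
  fin_cases I <;> simp [wedge] <;> fun_prop

theorem continuous_ctr (A : Matrix (Fin 6) (Fin 6) ℝ) (b : Fin 4) (I : Fin 6) :
    Continuous fun ξ => ctr A ξ b I := by
  fin_cases b <;> simp [ctr] <;> fun_prop

theorem continuous_fres (A : Matrix (Fin 6) (Fin 6) ℝ) : Continuous (fres A) := by
  have h := continuous_ctr A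
  have hs (b i j) : Continuous fun ξ => skew (fun J => ctr A ξ b (dual J)) i j := by
    simp only [skew_eq_sum (fun J => ctr A _ b (dual J))]
    fun_prop
  have hg (b a) : Continuous fun ξ => gramForm A ξ b a := by
    fin_cases a <;> simp [gramForm] <;> fun_prop
  unfold fres
  fun_prop

/-- Two continuous functions on `ℝ⁴` that agree where `ξ 0 ≠ 0` are equal. -/
theorem eq_of_eq_of_ne {f g : (Fin 4 → ℝ) → ℝ} (hf : Continuous f) (hg : Continuous g)
    (h : ∀ ξ, ξ 0 ≠ 0 → f ξ = g ξ) : f = g := by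
  funext ξ
  have hc : Continuous fun t : ℝ => Function.update ξ 0 t := by fun_prop
  have := Continuous.ext_on (dense_compl_singleton (0 : ℝ)) (hf.comp hc) (hg.comp hc)
    fun t ht => h _ (by simpa using ht)
  simpa using congrFun this (ξ 0)

theorem det_wedgeGram {A : Matrix (Fin 6) (Fin 6) ℝ} (hA : A.IsSymm) (ξ : Fin 4 → ℝ)
    (η : Fin 3 → Fin 4 → ℝ) :
    (wedgeGram A ξ η).det =
      (Matrix.of (Fin.cons ξ η : Fin 4 → Fin 4 → ℝ)).det ^ 2 * fres A ξ := by
  refine congrFun (eq_of_eq_of_ne (f := fun ξ => (wedgeGram A ξ η).det)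
    (g := fun ξ => (Matrix.of (Fin.cons ξ η : Fin 4 → Fin 4 → ℝ)).det ^ 2 * fres A ξ)
    ?_ ?_ fun ξ hξ => det_wedgeGram_of_ne hA hξ η) ξ
  · refine Continuous.matrix_det (continuous_matrix fun i j => ?_)
    exact (continuous_wedge continuous_id continuous_const).dotProduct
      (continuous_const.matrix_mulVec (continuous_wedge continuous_id continuous_const))
  · refine (Continuous.pow (Continuous.matrix_det (continuous_matrix fun i j => ?_)) 2).mul
      (continuous_fres A)
    refine Fin.cases ?_ (fun k => ?_) i <;> simp <;> fun_prop

theorem compound_mulVec_wedge (P : Matrix (Fin 4) (Fin 4) ℝ) (ξ η : Fin 4 → ℝ) :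
    compound P *ᵥ wedge ξ η = wedge (P *ᵥ ξ) (P *ᵥ η) := by
  funext I
  fin_cases I <;>
    simp [compound, wedge, mulVec, dotProduct, Fin.sum_univ_six, Fin.sum_univ_four, pairs] <;> ring

theorem fres_compound {A : Matrix (Fin 6) (Fin 6) ℝ} (hA : A.IsSymm)
    (P : Matrix (Fin 4) (Fin 4) ℝ) (ξ : Fin 4 → ℝ) :
    fres ((compound P)ᵀ * A * compound P) ξ = P.det ^ 2 * fres A (P *ᵥ ξ) := by
  refine congrFun (eq_of_eq_of_ne (f := fun ξ => fres ((compound P)ᵀ * A * compound P) ξ)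
    (g := fun ξ => P.det ^ 2 * fres A (P *ᵥ ξ)) (continuous_fres _)
    (continuous_const.mul ((continuous_fres A).comp (by fun_prop))) fun ξ hξ => ?_) ξ
  have hA' : ((compound P)ᵀ * A * compound P).IsSymm := by
    rw [IsSymm, transpose_mul, transpose_mul, transpose_transpose, hA.eq, Matrix.mul_assoc]
  set e : Fin 3 → Fin 4 → ℝ := fun k => Pi.single k.succ 1
  have h1 := det_wedgeGram hA' ξ e
  have h2 := det_wedgeGram hA (P *ᵥ ξ) fun i => P *ᵥ e i
  have h3 : wedgeGram ((compound P)ᵀ * A * compound P) ξ e =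
      wedgeGram A (P *ᵥ ξ) fun i => P *ᵥ e i := by
    ext i j
    simp only [wedgeGram, of_apply, ← compound_mulVec_wedge, ← mulVec_mulVec]
    rw [dotProduct_mulVec, vecMul_transpose]
  have h4 : (Matrix.of (Fin.cons (P *ᵥ ξ) fun i => P *ᵥ e i : Fin 4 → Fin 4 → ℝ)) =
      Matrix.of (Fin.cons ξ e : Fin 4 → Fin 4 → ℝ) * Pᵀ := by
    ext i j
    rw [mul_apply]
    refine Fin.cases ?_ (fun k => ?_) i <;>
      simp [mulVec, dotProduct, mul_comm]
  have h5 : (Matrix.of (Fin.cons ξ e : Fin 4 → Fin 4 → ℝ)).det = ξ 0 := by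
    rw [det_of_isUpperTriangular]
    · simp [Fin.prod_univ_succ, e]
    · intro i j hij
      revert hij
      refine Fin.cases (by simp) (fun k hk => ?_) i
      simp [e, (show j ≠ k.succ from ne_of_lt hk)]
  rw [h3, h2, h4, det_mul, det_transpose, h5] at h1
  have : ξ 0 ^ 2 ≠ 0 := pow_ne_zero _ hξ
  apply mul_left_cancel₀ this
  linear_combination -h1

theorem skew_of_antisymm {w : Fin 4 → Fin 4 → ℝ} (h : ∀ i j, w i j = -w j i) (i j : Fin 4) :
    skew (fun I => w (pairs I).1 (pairs I).2) i j = w i j := by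
  have h0 (i) : w i i = 0 := by linarith [h i i]
  fin_cases i <;> fin_cases j <;> simp [skew, pairs, h0] <;> exact (h _ _).symm

theorem skew_pairs (w : Fin 6 → ℝ) (I : Fin 6) : skew w (pairs I).1 (pairs I).2 = w I := by
  fin_cases I <;> simp [skew, pairs]

theorem medium_mat6 {κ : MT} (h : antisymMT κ) :
    κ = medium ((mat6 κ).submatrix dual id) := by
  funext i j r s
  have h1 (J : Fin 6) : skew (fun I => κ (pairs J).1 (pairs J).2 (pairs I).1 (pairs I).2) r s =
      κ (pairs J).1 (pairs J).2 r s := skew_of_antisymm (h.2 _ _) r s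
  have h2 : skew (fun J => κ (pairs J).1 (pairs J).2 r s) i j = κ i j r s :=
    skew_of_antisymm (w := fun i j => κ i j r s) (fun i j => h.1 i j r s) i j
  simp only [medium, submatrix_apply, dual_dual, id, mat6, h1, h2]

theorem mat6_medium (A : Matrix (Fin 6) (Fin 6) ℝ) : mat6 (medium A) = A.submatrix dual id := by
  ext I J
  simp only [mat6, medium, skew_pairs, submatrix_apply, id]

theorem bform_eq_skew (I : Fin 6) (i j : Fin 4) : bform I i j = skew (Pi.single I 1) i j := by
  fin_cases I <;> fin_cases i <;> fin_cases j <;> simp [bform, skew, pairs]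

theorem tensorOf_eq_medium (R : Matrix (Fin 6) (Fin 6) ℝ) :
    tensorOf R = medium (R.submatrix dual id) := by
  funext i j r s
  rw [medium_eq, skew_eq_sum]
  simp only [submatrix_apply, dual_dual, tensorOf, bform_eq_skew, id]
  refine Finset.sum_congr rfl fun I _ => ?_
  rw [skew_eq_sum (fun J => R I J), Finset.sum_mul]

theorem eps_swap_pairs (a b c d : Fin 4) : eps a b c d = eps c d a b := by
  unfold eps; ring

theorem adjT_medium (A : Matrix (Fin 6) (Fin 6) ℝ) : adjT (medium A) = medium Aᵀ := by
  funext i j r s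
  have h (a b) : ∑ c, ∑ d, eps r s a b * medium A a b c d * eps c d i j =
      2 * (skew (fun J => skew (fun K => A J K) a b) i j * eps a b r s) := by
    simp only [medium_eq, mul_assoc, ← Finset.mul_sum, eps_sum_skew, dual_dual]
    rw [eps_swap_pairs r s]; ring
  have h' : ∀ a b, skew (fun J => skew (fun K => A J K) a b) i j =
      skew (fun K => skew (fun J => A J K) i j) a b := by
    intro a b
    have := medium_eq (A.submatrix dual id) a b i j
    simp only [medium, submatrix_apply, id, dual_dual] at this
    exact this.symm
  simp only [adjT, h, h']
  simp only [← Finset.mul_sum, eps_sum_skew, medium_eq, transpose_apply]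
  ring

theorem isSymm_of_adjT {κ : MT} (h : antisymMT κ) (h' : adjT κ = κ) :
    ((mat6 κ).submatrix dual id).IsSymm := by
  have h1 := medium_mat6 h
  set A := (mat6 κ).submatrix dual id
  rw [h1, adjT_medium] at h'
  have := congrArg mat6 h'
  rw [mat6_medium, mat6_medium] at this
  ext I J
  have := congrFun (congrFun this (dual I)) J
  simpa [dual_dual] using this

theorem wedge_single (J : Fin 6) :
    wedge (Pi.single (pairs J).1 1) (Pi.single (pairs J).2 1) = Pi.single J 1 := by
  funext I
  fin_cases J <;> fin_cases I <;> simp [wedge, pairs]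

theorem compound_mul (P Q : Matrix (Fin 4) (Fin 4) ℝ) :
    compound (P * Q) = compound P * compound Q := by
  apply Matrix.ext_of_mulVec_single
  intro J
  rw [← wedge_single J, ← mulVec_mulVec]
  simp only [compound_mulVec_wedge, mulVec_mulVec]

theorem compound_one : compound 1 = 1 := by
  apply Matrix.ext_of_mulVec_single
  intro J
  rw [← wedge_single J, compound_mulVec_wedge, one_mulVec, one_mulVec, one_mulVec]

set_option maxHeartbeats 1000000 in
theorem compound_transpose_mul (P : Matrix (Fin 4) (Fin 4) ℝ) :
    (compound P)ᵀ * (compound P).submatrix dual id = P.det • (1 : Matrix _ _ ℝ).submatrix dual id := by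
  obtain ⟨d, hd⟩ : ∃ d, P.det = d := ⟨_, rfl⟩
  have hd' := hd
  simp [det_succ_row_zero, Fin.sum_univ_succ, Fin.succAbove] at hd'
  rw [hd, ← hd']
  ext I J
  simp only [mul_apply, transpose_apply, submatrix_apply, id, Matrix.smul_apply, one_apply, smul_eq_mul,
    Fin.sum_univ_six, compound]
  fin_cases I <;> fin_cases J <;> simp [dual, pairs] <;> ring

/-- The bilinear form of a twisted medium tensor in the frame `f`. -/
def pull (f : Matrix (Fin 4) (Fin 4) ℝ) (A : Matrix (Fin 6) (Fin 6) ℝ) : Matrix (Fin 6) (Fin 6) ℝ :=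
  |f.det|⁻¹ • ((compound f)ᵀ * A * compound f)

theorem pull_mul (f g : Matrix (Fin 4) (Fin 4) ℝ) (A : Matrix (Fin 6) (Fin 6) ℝ) :
    pull g (pull f A) = pull (f * g) A := by
  simp only [pull, compound_mul, det_mul, abs_mul, mul_inv, transpose_mul, Matrix.mul_smul,
    Matrix.smul_mul, smul_smul, Matrix.mul_assoc]
  rw [mul_comm]

theorem pull_isSymm {A : Matrix (Fin 6) (Fin 6) ℝ} (hA : A.IsSymm) (f : Matrix (Fin 4) (Fin 4) ℝ) :
    (pull f A).IsSymm := by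
  rw [pull, IsSymm, transpose_smul, transpose_mul, transpose_mul, transpose_transpose, hA.eq,
    Matrix.mul_assoc]

theorem isUnit_det_compound {f : Matrix (Fin 4) (Fin 4) ℝ} (hf : f.det ≠ 0) :
    IsUnit (compound f).det := by
  have h : compound f * compound f⁻¹ = 1 := by
    rw [← compound_mul, mul_nonsing_inv _ (isUnit_iff_ne_zero.2 hf), compound_one]
  exact (Matrix.isUnit_iff_isUnit_det _).1 (IsUnit.of_mul_eq_one _ h)

theorem det_pull_ne {A : Matrix (Fin 6) (Fin 6) ℝ} (hA : A.det ≠ 0) {f : Matrix (Fin 4) (Fin 4) ℝ}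
    (hf : f.det ≠ 0) : (pull f A).det ≠ 0 := by
  have := (isUnit_det_compound hf).ne_zero
  rw [pull, det_smul, det_mul, det_mul, det_transpose]
  have h : |f.det|⁻¹ ≠ 0 := by simpa using hf
  positivity

theorem fres_smul (c : ℝ) (A : Matrix (Fin 6) (Fin 6) ℝ) (ξ : Fin 4 → ℝ) :
    fres (c • A) ξ = c ^ 3 * fres A ξ := by
  have h1 (b I) : ctr (c • A) ξ b I = c * ctr A ξ b I := by
    fin_cases b <;> simp [ctr] <;> ring
  have h2 (b a) : gramForm (c • A) ξ b a = c * gramForm A ξ b a := by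
    fin_cases a <;> simp [gramForm, h1] <;> ring
  have h3 (b i j) : skew (fun J => ctr (c • A) ξ b (dual J)) i j =
      c * skew (fun J => ctr A ξ b (dual J)) i j := by
    rw [skew_eq_sum, skew_eq_sum (fun J => ctr A ξ b (dual J)), Finset.mul_sum]
    exact Finset.sum_congr rfl fun _ _ => by rw [h1]; ring
  simp only [fres, h2, h3, Finset.mul_sum]
  repeat' refine Finset.sum_congr rfl fun _ _ => ?_
  ring

theorem fres_pull {A : Matrix (Fin 6) (Fin 6) ℝ} (hA : A.IsSymm) {f : Matrix (Fin 4) (Fin 4) ℝ}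
    (hf : f.det ≠ 0) (ξ : Fin 4 → ℝ) : fres (pull f A) ξ = |f.det|⁻¹ * fres A (f *ᵥ ξ) := by
  rw [pull, fres_smul, fres_compound hA, ← sq_abs]
  have : |f.det| ≠ 0 := abs_ne_zero.2 hf
  field_simp

theorem inClass_of_pull {A : Matrix (Fin 6) (Fin 6) ℝ} {f : Matrix (Fin 4) (Fin 4) ℝ}
    (hf : f.det ≠ 0) {C : Matrix (Fin 6) (Fin 6) ℝ → Prop}
    (h : C ((pull f A).submatrix dual id)) : InClass (A.submatrix dual id) C := by
  have hu : IsUnit f.det := isUnit_iff_ne_zero.2 hf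
  refine ⟨f⁻¹, by rwa [isUnit_nonsing_inv_det_iff], ?_⟩
  set E : Matrix (Fin 6) (Fin 6) ℝ := (1 : Matrix (Fin 6) (Fin 6) ℝ).submatrix dual id with hE
  have hEm (X : Matrix (Fin 6) (Fin 6) ℝ) : X.submatrix dual id = E * X := by
    ext I J
    simp [hE, mul_apply, one_apply]
  have hEE : E * E = 1 := by
    rw [← hEm, hE]; ext I J; simp [one_apply, dual_dual]
  set F := compound f with hF
  have h1 : compound f⁻¹ * F = 1 := by
    rw [hF, ← compound_mul, nonsing_inv_mul _ hu, compound_one]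
  have h2 : compound f⁻¹ = f.det⁻¹ • (E * Fᵀ * E) := by
    have h3 := compound_transpose_mul f
    rw [hEm, ← hE, ← hF] at h3
    have h4 : (f.det⁻¹ • (E * Fᵀ * E)) * F = 1 := by
      rw [Matrix.smul_mul, Matrix.mul_assoc, Matrix.mul_assoc, h3, Matrix.mul_smul, hEE, smul_smul,
        inv_mul_cancel₀ hf, one_smul]
    rw [← inv_eq_left_inv h4, ← inv_eq_left_inv h1]
  have h5 : (compound f⁻¹)⁻¹ = F := inv_eq_right_inv h1
  rw [h5, h2, det_nonsing_inv, hEm]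
  rw [hEm, pull, ← hF] at h
  convert h using 1
  have h6 : Real.sign (Ring.inverse f.det) * f.det⁻¹ = |f.det|⁻¹ := by
    rw [Ring.inverse_eq_inv']
    rcases lt_or_gt_of_ne hf with h | h
    · rw [Real.sign_of_neg (inv_lt_zero.2 h), abs_of_neg h, inv_neg]; ring
    · rw [Real.sign_of_pos (inv_pos.2 h), abs_of_pos h]; ring
  have h7 : E * Fᵀ * E * (E * A) * F = E * (Fᵀ * A * F) := by
    calc _ = E * Fᵀ * (E * E) * A * F := by simp only [Matrix.mul_assoc]
      _ = _ := by rw [hEE]; simp only [Matrix.mul_assoc, Matrix.one_mul]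
  rw [Matrix.smul_mul, Matrix.smul_mul, smul_smul, h6, h7, Matrix.mul_smul]

/-- `A` takes one of the three normal forms in a suitable frame. -/
def Classified (A : Matrix (Fin 6) (Fin 6) ℝ) : Prop :=
  ∃ f : Matrix (Fin 4) (Fin 4) ℝ, f.det ≠ 0 ∧ (MetaI ((pull f A).submatrix dual id) ∨
    MetaII ((pull f A).submatrix dual id) ∨ MetaIV ((pull f A).submatrix dual id))

theorem Classified.of_pull {A : Matrix (Fin 6) (Fin 6) ℝ} {f : Matrix (Fin 4) (Fin 4) ℝ}
    (hf : f.det ≠ 0) (h : Classified (pull f A)) : Classified A := by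
  obtain ⟨g, hg, h⟩ := h
  rw [pull_mul] at h
  exact ⟨f * g, by rw [det_mul]; exact mul_ne_zero hf hg, h⟩

theorem Classified.inClass {A : Matrix (Fin 6) (Fin 6) ℝ} (h : Classified A) :
    InClass (A.submatrix dual id) MetaI ∨ InClass (A.submatrix dual id) MetaII ∨
      InClass (A.submatrix dual id) MetaIV := by
  obtain ⟨f, hf, h | h | h⟩ := h
  · exact Or.inl (inClass_of_pull hf h)
  · exact Or.inr (Or.inl (inClass_of_pull hf h))
  · exact Or.inr (Or.inr (inClass_of_pull hf h))

theorem AnalyticOnNhd.eq_zero_or_eq_zero {E : Type*} [NormedAddCommGroup E] [NormedSpace ℝ E]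
    {f g : E → ℝ} (hf : AnalyticOnNhd ℝ f Set.univ) (hg : AnalyticOnNhd ℝ g Set.univ)
    (h : ∀ x, f x * g x = 0) : (∀ x, f x = 0) ∨ ∀ x, g x = 0 := by
  by_contra! hne
  obtain ⟨⟨a, ha⟩, b, hb⟩ := hne
  have h1 : ∀ᶠ x in nhds a, f x ≠ 0 :=
    (hf a (Set.mem_univ _)).continuousAt.eventually_ne ha
  have h2 : g =ᶠ[nhds a] 0 := by
    filter_upwards [h1] with x hx
    exact (mul_eq_zero.1 (h x)).resolve_left hx
  exact hb (hg.eqOn_zero_of_preconnected_of_eventuallyEq_zero isPreconnected_univ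
    (Set.mem_univ a) h2 (Set.mem_univ b))

/-- The quadratic form of a standard Lorentz metric in null coordinates. -/
def nullForm (ξ : Fin 4 → ℝ) : ℝ := ξ 0 * ξ 1 - ξ 2 ^ 2 - ξ 3 ^ 2

/-- Parametrisation of the null cone of `nullForm`. -/
def nullRay (u v : ℝ) : Fin 4 → ℝ := ![1, u ^ 2 + v ^ 2, u, v]

/-- The quadratic form on `ℝ⁴` with given coefficients. -/
def quad (k : Fin 10 → ℝ) (ξ : Fin 4 → ℝ) : ℝ :=
  k 0 * ξ 0 ^ 2 + k 1 * (ξ 0 * ξ 1) + k 2 * (ξ 0 * ξ 2) + k 3 * (ξ 0 * ξ 3) + k 4 * ξ 1 ^ 2 +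
    k 5 * (ξ 1 * ξ 2) + k 6 * (ξ 1 * ξ 3) + k 7 * ξ 2 ^ 2 + k 8 * (ξ 2 * ξ 3) + k 9 * ξ 3 ^ 2

theorem quad_eq_nullForm {k : Fin 10 → ℝ} (h : ∀ u v, quad k (nullRay u v) = 0) (ξ : Fin 4 → ℝ) :
    quad k ξ = k 1 * nullForm ξ := by
  have e (u v) := h u v
  simp [quad, nullRay] at e
  have h0 := e 0 0
  have h1 := e 1 0
  have h2 := e (-1) 0
  have h3 := e 2 0
  have h3' := e (-2) 0
  have h4 := e 0 1
  have h5 := e 0 (-1)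
  have h6 := e 0 2
  have h6' := e 0 (-2)
  have h7 := e 1 1
  norm_num at h0 h1 h2 h3 h3' h4 h5 h6 h6' h7
  have r2 : k 2 = 0 := by linarith
  have r3 : k 3 = 0 := by linarith
  have r4 : k 4 = 0 := by linarith
  have r5 : k 5 = 0 := by linarith
  have r6 : k 6 = 0 := by linarith
  have r7 : k 7 = -k 1 := by linarith
  have r9 : k 9 = -k 1 := by linarith
  have r8 : k 8 = 0 := by linarith
  simp only [quad, nullForm, h0, r2, r3, r4, r5, r6, r7, r8, r9]
  ring

theorem exists_quad (B : Matrix (Fin 4) (Fin 4) ℝ) :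
    ∃ k, ∀ ξ, ξ ⬝ᵥ B *ᵥ ξ = quad k ξ := by
  refine ⟨![B 0 0, B 0 1 + B 1 0, B 0 2 + B 2 0, B 0 3 + B 3 0, B 1 1, B 1 2 + B 2 1,
    B 1 3 + B 3 1, B 2 2, B 2 3 + B 3 2, B 3 3], fun ξ => ?_⟩
  simp [quad, dotProduct, mulVec, Fin.sum_univ_four]
  ring

theorem exists_matrix (k : Fin 10 → ℝ) :
    ∃ B : Matrix (Fin 4) (Fin 4) ℝ, B.IsSymm ∧ ∀ ξ, quad k ξ = ξ ⬝ᵥ B *ᵥ ξ := by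
  refine ⟨!![k 0, k 1 / 2, k 2 / 2, k 3 / 2; k 1 / 2, k 4, k 5 / 2, k 6 / 2;
    k 2 / 2, k 5 / 2, k 7, k 8 / 2; k 3 / 2, k 6 / 2, k 8 / 2, k 9], ?_, fun ξ => ?_⟩
  · ext i j; fin_cases i <;> fin_cases j <;> rfl
  · simp [quad, dotProduct, mulVec, Fin.sum_univ_four]
    ring

theorem analyticOnNhd_quad (k : Fin 10 → ℝ) : AnalyticOnNhd ℝ (quad k) Set.univ := by
  have : ContDiff ℝ ⊤ (quad k) := by unfold quad; fun_prop
  exact this.analyticOnNhd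

theorem analyticOnNhd_quad_nullRay (k : Fin 10 → ℝ) :
    AnalyticOnNhd ℝ (fun p : ℝ × ℝ => quad k (nullRay p.1 p.2)) Set.univ := by
  have : ContDiff ℝ ⊤ fun p : ℝ × ℝ => quad k (nullRay p.1 p.2) := by
    simp [quad, nullRay]; fun_prop
  exact this.analyticOnNhd

theorem quad_mul_nullRay {k l : Fin 10 → ℝ}
    (h : ∀ u v, quad k (nullRay u v) * quad l (nullRay u v) = 0) :
    (∀ ξ, quad k ξ = k 1 * nullForm ξ) ∨ ∀ ξ, quad l ξ = l 1 * nullForm ξ := by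
  refine ((analyticOnNhd_quad_nullRay k).eq_zero_or_eq_zero (analyticOnNhd_quad_nullRay l)
    fun p => h p.1 p.2).imp ?_ ?_ <;>
  exact fun h => quad_eq_nullForm fun u v => h (u, v)

/-- Linear forms. -/
def IsLin (F : (Fin 4 → ℝ) → ℝ) : Prop := ∃ w, ∀ ξ, F ξ = w ⬝ᵥ ξ

/-- Quadratic forms. -/
def IsQuad (F : (Fin 4 → ℝ) → ℝ) : Prop := ∃ k, ∀ ξ, F ξ = quad k ξ

theorem IsLin.add {F G : (Fin 4 → ℝ) → ℝ} (hF : IsLin F) (hG : IsLin G) :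
    IsLin fun ξ => F ξ + G ξ := by
  obtain ⟨w, hw⟩ := hF
  obtain ⟨z, hz⟩ := hG
  exact ⟨w + z, fun ξ => by beta_reduce; rw [hw, hz, add_dotProduct]⟩

theorem IsLin.const_mul {F : (Fin 4 → ℝ) → ℝ} (hF : IsLin F) (c : ℝ) :
    IsLin fun ξ => c * F ξ := by
  obtain ⟨w, hw⟩ := hF
  exact ⟨c • w, fun ξ => by beta_reduce; rw [hw, smul_dotProduct, smul_eq_mul]⟩

theorem IsLin.sum {ι : Type*} (s : Finset ι) {F : ι → (Fin 4 → ℝ) → ℝ} (hF : ∀ i, IsLin (F i)) :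
    IsLin fun ξ => ∑ i ∈ s, F i ξ := by
  choose w hw using hF
  exact ⟨∑ i ∈ s, w i, fun ξ => by simp only [hw, sum_dotProduct]⟩

theorem isLin_apply (i : Fin 4) : IsLin fun ξ => ξ i :=
  ⟨Pi.single i 1, fun ξ => by simp⟩

theorem IsLin.mul {F G : (Fin 4 → ℝ) → ℝ} (hF : IsLin F) (hG : IsLin G) :
    IsQuad fun ξ => F ξ * G ξ := by
  obtain ⟨w, hw⟩ := hF
  obtain ⟨z, hz⟩ := hG
  obtain ⟨k, hk⟩ := exists_quad (vecMulVec w z)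
  refine ⟨k, fun ξ => ?_⟩
  beta_reduce
  rw [← hk, hw, hz, vecMulVec_mulVec]
  simp [dotProduct_comm ξ w, mul_comm]

theorem quad_add (k l : Fin 10 → ℝ) (ξ : Fin 4 → ℝ) : quad (k + l) ξ = quad k ξ + quad l ξ := by
  simp only [quad, Pi.add_apply]; ring

theorem quad_smul (c : ℝ) (k : Fin 10 → ℝ) (ξ : Fin 4 → ℝ) : quad (c • k) ξ = c * quad k ξ := by
  simp only [quad, Pi.smul_apply, smul_eq_mul]; ring

theorem IsQuad.add {F G : (Fin 4 → ℝ) → ℝ} (hF : IsQuad F) (hG : IsQuad G) :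
    IsQuad fun ξ => F ξ + G ξ := by
  obtain ⟨w, hw⟩ := hF
  obtain ⟨z, hz⟩ := hG
  exact ⟨w + z, fun ξ => by beta_reduce; rw [hw, hz, quad_add]⟩

theorem IsQuad.const_mul {F : (Fin 4 → ℝ) → ℝ} (hF : IsQuad F) (c : ℝ) :
    IsQuad fun ξ => c * F ξ := by
  obtain ⟨w, hw⟩ := hF
  exact ⟨c • w, fun ξ => by beta_reduce; rw [hw, quad_smul]⟩

/-- Functions that differ from a multiple of `nullForm` by a function of degree at most one in
the third coordinate. -/
def IsReducible (F : (Fin 4 → ℝ) → ℝ) : Prop :=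
  ∃ (k : Fin 10 → ℝ) (P R : ℝ × ℝ × ℝ → ℝ), ContDiff ℝ ⊤ P ∧ ContDiff ℝ ⊤ R ∧
    ∀ ξ, F ξ = P (ξ 0, ξ 1, ξ 3) + ξ 2 * R (ξ 0, ξ 1, ξ 3) + nullForm ξ * quad k ξ

theorem IsReducible.add {F G : (Fin 4 → ℝ) → ℝ} (hF : IsReducible F) (hG : IsReducible G) :
    IsReducible fun ξ => F ξ + G ξ := by
  obtain ⟨k, P, R, hP, hR, h⟩ := hF
  obtain ⟨k', P', R', hP', hR', h'⟩ := hG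
  exact ⟨k + k', P + P', R + R', hP.add hP', hR.add hR', fun ξ => by
    beta_reduce; rw [h, h', quad_add, Pi.add_apply, Pi.add_apply]; ring⟩

theorem isReducible_zero : IsReducible fun _ => 0 :=
  ⟨0, 0, 0, contDiff_const, contDiff_const, fun ξ => by simp [quad]⟩

theorem IsReducible.sum {ι : Type*} (s : Finset ι) {F : ι → (Fin 4 → ℝ) → ℝ}
    (hF : ∀ i, IsReducible (F i)) : IsReducible fun ξ => ∑ i ∈ s, F i ξ := by
  classical
  induction s using Finset.induction_on with
  | empty => simpa using isReducible_zero
  | insert a s ha ih => simpa only [Finset.sum_insert ha] using (hF a).add ih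

theorem IsQuad.mul {F G : (Fin 4 → ℝ) → ℝ} (hF : IsQuad F) (hG : IsQuad G) :
    IsReducible fun ξ => F ξ * G ξ := by
  obtain ⟨k, hk⟩ := hF
  obtain ⟨l, hl⟩ := hG
  let a : (Fin 10 → ℝ) → ℝ × ℝ × ℝ → ℝ := fun k p =>
    k 0 * p.1 ^ 2 + k 1 * (p.1 * p.2.1) + k 3 * (p.1 * p.2.2) + k 4 * p.2.1 ^ 2 +
      k 6 * (p.2.1 * p.2.2) + k 9 * p.2.2 ^ 2
  let b : (Fin 10 → ℝ) → ℝ × ℝ × ℝ → ℝ := fun k p => k 2 * p.1 + k 5 * p.2.1 + k 8 * p.2.2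
  let s : ℝ × ℝ × ℝ → ℝ := fun p => p.1 * p.2.1 - p.2.2 ^ 2
  refine ⟨![-(k 0 * l 7 + k 2 * l 2 + k 7 * l 0),
      -(k 1 * l 7 + k 2 * l 5 + k 5 * l 2 + k 7 * l 1) - k 7 * l 7,
      -(k 2 * l 7 + k 7 * l 2),
      -(k 3 * l 7 + k 2 * l 8 + k 8 * l 2 + k 7 * l 3),
      -(k 4 * l 7 + k 5 * l 5 + k 7 * l 4),
      -(k 5 * l 7 + k 7 * l 5),
      -(k 6 * l 7 + k 5 * l 8 + k 8 * l 5 + k 7 * l 6),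
      -(k 7 * l 7),
      -(k 8 * l 7 + k 7 * l 8),
      -(k 9 * l 7 + k 8 * l 8 + k 7 * l 9) + k 7 * l 7],
    fun p => a k p * a l p + s p * (a k p * l 7 + b k p * b l p + k 7 * a l p) +
      s p ^ 2 * (k 7 * l 7),
    fun p => a k p * b l p + b k p * a l p + s p * (b k p * l 7 + k 7 * b l p), ?_, ?_, ?_⟩
  · simp only [a, b, s]
    fun_prop
  · simp only [a, b, s]
    fun_prop
  · intro ξ
    simp [hk, hl, quad, a, b, s, nullForm]
    ring

theorem isLin_ctr (A : Matrix (Fin 6) (Fin 6) ℝ) (b : Fin 4) (I : Fin 6) :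
    IsLin fun ξ => ctr A ξ b I := by
  have h (c : ℝ) (i : Fin 4) : IsLin fun ξ => c * ξ i := (isLin_apply i).const_mul c
  fin_cases b
  · convert ((h (A 0 I) 1).add (h (A 1 I) 2)).add (h (A 2 I) 3) using 2
    simp [ctr]
  · convert ((h (-A 0 I) 0).add (h (A 5 I) 2)).add (h (-A 4 I) 3) using 2
    simp [ctr]; ring
  · convert ((h (-A 1 I) 0).add (h (-A 5 I) 1)).add (h (A 3 I) 3) using 2
    simp [ctr]; ring
  · convert ((h (-A 2 I) 0).add (h (A 4 I) 1)).add (h (-A 3 I) 2) using 2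
    simp [ctr]; ring

theorem isQuad_gramForm (A : Matrix (Fin 6) (Fin 6) ℝ) (b a : Fin 4) :
    IsQuad fun ξ => gramForm A ξ b a := by
  have h (c : ℝ) (I : Fin 6) (i : Fin 4) : IsQuad fun ξ => c * (ctr A ξ b I * ξ i) :=
    ((isLin_ctr A b I).mul (isLin_apply i)).const_mul c
  fin_cases a
  · convert ((h 1 0 1).add (h 1 1 2)).add (h 1 2 3) using 2
    simp [gramForm]
  · convert ((h (-1) 0 0).add (h 1 5 2)).add (h (-1) 4 3) using 2
    simp [gramForm]; ring
  · convert ((h (-1) 1 0).add (h (-1) 5 1)).add (h 1 3 3) using 2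
    simp [gramForm]; ring
  · convert ((h (-1) 2 0).add (h 1 4 1)).add (h (-1) 3 2) using 2
    simp [gramForm]; ring

theorem isReducible_fres (A : Matrix (Fin 6) (Fin 6) ℝ) : IsReducible (fres A) := by
  have h (b i j) : IsLin fun ξ => skew (fun J => ctr A ξ b (dual J)) i j := by
    simp only [skew_eq_sum (fun J => ctr A _ b (dual J)), mul_comm (ctr A _ _ _)]
    exact IsLin.sum _ fun I => (isLin_ctr A b _).const_mul _
  unfold fres
  simp only [Finset.mul_sum]
  refine IsReducible.sum _ fun a => IsReducible.sum _ fun c => IsReducible.sum _ fun b =>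
    IsReducible.sum _ fun d => ?_
  simpa only [mul_assoc] using
    ((isQuad_gramForm A d a).const_mul (1 / 6)).mul ((h b a c).mul (h c b d))

theorem IsReducible.exists_eq_mul {F : (Fin 4 → ℝ) → ℝ} (hF : IsReducible F)
    (h : ∀ ξ, nullForm ξ = 0 → F ξ = 0) : ∃ k, ∀ ξ, F ξ = nullForm ξ * quad k ξ := by
  obtain ⟨k, P, R, hP, hR, hF⟩ := hF
  have key : ∀ p : ℝ × ℝ × ℝ, 0 < p.1 * p.2.1 - p.2.2 ^ 2 → P p = 0 ∧ R p = 0 := by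
    rintro ⟨x, y, v⟩ hp
    simp only at hp
    set r := Real.sqrt (x * y - v ^ 2)
    have hr : r ^ 2 = x * y - v ^ 2 := Real.sq_sqrt hp.le
    have hr0 : 0 < r := Real.sqrt_pos.2 hp
    have h1 := h ![x, y, r, v] (by simp [nullForm, hr])
    have h2 := h ![x, y, -r, v] (by simp [nullForm, hr])
    rw [hF] at h1 h2
    simp [nullForm, hr] at h1 h2
    have h3 : r * R (x, y, v) = 0 := by linarith
    have h4 := (mul_eq_zero.1 h3).resolve_left hr0.ne'
    exact ⟨by rw [h4] at h1; linarith, h4⟩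
  have hev : ∀ᶠ p : ℝ × ℝ × ℝ in nhds (1, 1, 0), 0 < p.1 * p.2.1 - p.2.2 ^ 2 := by
    refine (isOpen_lt continuous_const (by fun_prop)).mem_nhds ?_
    simp
  have hP0 := hP.analyticOnNhd.eqOn_zero_of_preconnected_of_eventuallyEq_zero isPreconnected_univ
    (Set.mem_univ _) (hev.mono fun p hp => (key p hp).1)
  have hR0 := hR.analyticOnNhd.eqOn_zero_of_preconnected_of_eventuallyEq_zero isPreconnected_univ
    (Set.mem_univ _) (hev.mono fun p hp => (key p hp).2)
  refine ⟨k, fun ξ => ?_⟩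
  rw [hF, hP0 (Set.mem_univ _), hR0 (Set.mem_univ _)]
  simp

theorem exists_diagonal_sign {n : Type*} [Fintype n] [DecidableEq n] {γ : Matrix n n ℝ}
    (hs : γ.IsSymm) (hd : γ.det ≠ 0) : ∃ (f : Matrix n n ℝ) (l e : n → ℝ), f.det ≠ 0 ∧
      γ.det = ∏ i, l i ∧ (∀ i, l i = e i * |l i|) ∧ (∀ i, e i = 1 ∨ e i = -1) ∧
        fᵀ * γ * f = diagonal e := by
  have hH : γ.IsHermitian := by rwa [IsHermitian, conjTranspose_eq_transpose_of_trivial]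
  set l := hH.eigenvalues
  have hl : γ.det = ∏ i, l i := by simpa using hH.det_eq_prod_eigenvalues
  have hl0 (i) : l i ≠ 0 := fun h => hd (hl.trans (Finset.prod_eq_zero (Finset.mem_univ i) h))
  set U : Matrix n n ℝ := hH.eigenvectorUnitary.1
  have hU : Uᵀ * U = 1 := by
    have := Unitary.coe_star_mul_self hH.eigenvectorUnitary
    rwa [star_eq_conjTranspose, conjTranspose_eq_transpose_of_trivial] at this
  have hUd : U.det ≠ 0 := by
    have := congrArg det hU
    rw [det_mul, det_one] at this
    exact right_ne_zero_of_mul_eq_one this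
  have hdiag : Uᵀ * γ * U = diagonal l := by
    have := hH.conjStarAlgAut_star_eigenvectorUnitary
    rw [Unitary.conjStarAlgAut_star_apply] at this
    simpa [star_eq_conjTranspose, conjTranspose_eq_transpose_of_trivial] using this
  set d : n → ℝ := fun i => (Real.sqrt |l i|)⁻¹
  have hsq (i) : 0 < Real.sqrt |l i| := Real.sqrt_pos.2 (abs_pos.2 (hl0 i))
  refine ⟨U * diagonal d, l, fun i => SignType.sign (l i), ?_, hl, fun i => ?_, fun i => ?_, ?_⟩
  · rw [det_mul, det_diagonal]
    exact mul_ne_zero hUd (Finset.prod_ne_zero_iff.2 fun i _ => (inv_pos.2 (hsq i)).ne')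
  · exact (sign_mul_abs _).symm
  · rcases lt_or_gt_of_ne (hl0 i) with h | h <;> simp [h]
  · calc _ = diagonal d * (Uᵀ * γ * U) * diagonal d := by
          simp only [transpose_mul, diagonal_transpose, Matrix.mul_assoc]
      _ = _ := by
        rw [hdiag, diagonal_mul_diagonal, diagonal_mul_diagonal]
        congr 1
        ext i
        have h1 := Real.mul_self_sqrt (abs_nonneg (l i))
        have h2 := (hsq i).ne'
        have h3 := (sign_mul_abs (l i)).symm
        simp only [d]
        field_simp
        rw [pow_two, h1]
        linear_combination h3

theorem exists_nullForm_frame {γ : Matrix (Fin 4) (Fin 4) ℝ} (hs : γ.IsSymm) (hd : γ.det < 0) :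
    ∃ f : Matrix (Fin 4) (Fin 4) ℝ, f.det ≠ 0 ∧ ∃ c : ℝ, c ≠ 0 ∧
      ∀ ξ, (f *ᵥ ξ) ⬝ᵥ γ *ᵥ (f *ᵥ ξ) = c * nullForm ξ := by
  obtain ⟨f, l, e, hf, hl, hle, he, hfe⟩ := exists_diagonal_sign hs hd.ne
  have hprod : e 0 * e 1 * e 2 * e 3 = -1 := by
    have h0 : e 0 * e 1 * e 2 * e 3 * (|l 0| * |l 1| * |l 2| * |l 3|) < 0 := by
      rw [hl, Fin.prod_univ_four, hle 0, hle 1, hle 2, hle 3] at hd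
      linarith
    have hpm : e 0 * e 1 * e 2 * e 3 = 1 ∨ e 0 * e 1 * e 2 * e 3 = -1 := by
      rcases he 0 with h0 | h0 <;> rcases he 1 with h1 | h1 <;> rcases he 2 with h2 | h2 <;>
        rcases he 3 with h3 | h3 <;> simp [h0, h1, h2, h3]
    refine hpm.resolve_left fun h => ?_
    rw [h] at h0
    exact h0.not_ge (by positivity)
  have hi : ∃ i, ∀ j, j ≠ i → e j = -e i := by
    rcases he 0 with h0 | h0 <;> rcases he 1 with h1 | h1 <;> rcases he 2 with h2 | h2 <;>
      rcases he 3 with h3 | h3 <;> simp only [h0, h1, h2, h3] at hprod <;> norm_num at hprod <;>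
      first
      | (refine ⟨0, fun j hj => ?_⟩
         fin_cases j <;> first | exact absurd rfl hj | (simp [h0, h1, h2, h3]; done))
      | (refine ⟨1, fun j hj => ?_⟩
         fin_cases j <;> first | exact absurd rfl hj | (simp [h0, h1, h2, h3]; done))
      | (refine ⟨2, fun j hj => ?_⟩
         fin_cases j <;> first | exact absurd rfl hj | (simp [h0, h1, h2, h3]; done))
      | (refine ⟨3, fun j hj => ?_⟩
         fin_cases j <;> first | exact absurd rfl hj | simp [h0, h1, h2, h3])
  obtain ⟨i, hi⟩ := hi
  let N : Matrix (Fin 4) (Fin 4) ℝ :=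
    !![1 / 2, 1 / 2, 0, 0; 1 / 2, -(1 / 2), 0, 0; 0, 0, 1, 0; 0, 0, 0, 1]
  have hN : N.det ≠ 0 := by
    have h : N * !![1, 1, 0, 0; 1, -1, 0, 0; 0, 0, 1, 0; 0, 0, 0, 1] = 1 := by
      ext i j
      fin_cases i <;> fin_cases j <;> simp [N, mul_apply, Fin.sum_univ_four] <;> norm_num
    exact left_ne_zero_of_mul_eq_one (by rw [← det_mul, h, det_one])
  refine ⟨f * N.submatrix (Equiv.swap 0 i) id, ?_, e i, ?_, fun ξ => ?_⟩
  · have := det_permute (Equiv.swap 0 i) N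
    rw [det_mul, this]
    refine mul_ne_zero hf (mul_ne_zero ?_ hN)
    exact_mod_cast Units.ne_zero _
  · rcases he i with h | h <;> simp [h]
  · set z := N.submatrix (Equiv.swap 0 i) id *ᵥ ξ with hz
    have hz' (j) : z j = (N *ᵥ ξ) (Equiv.swap 0 i j) := rfl
    have h1 : ((f * N.submatrix (Equiv.swap 0 i) id) *ᵥ ξ) ⬝ᵥ
        γ *ᵥ ((f * N.submatrix (Equiv.swap 0 i) id) *ᵥ ξ) = z ⬝ᵥ (fᵀ * γ * f) *ᵥ z := by
      rw [← mulVec_mulVec, ← hz, ← mulVec_mulVec, ← mulVec_mulVec, dotProduct_mulVec z,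
        vecMul_transpose]
    have h2 : ∑ j, e j * z j ^ 2 = ∑ j, e (Equiv.swap 0 i j) * (N *ᵥ ξ) j ^ 2 := by
      rw [← Equiv.sum_comp (Equiv.swap 0 i)]
      simp only [hz', Equiv.swap_apply_self]
    rw [h1, hfe]
    have h3 : z ⬝ᵥ diagonal e *ᵥ z = ∑ j, e j * z j ^ 2 := by
      simp only [dotProduct, mulVec_diagonal]
      exact Finset.sum_congr rfl fun _ _ => by ring
    have h4 (j : Fin 4) (hj : j ≠ 0) : e (Equiv.swap 0 i j) = -e i :=
      hi _ fun h => hj (by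
        rw [Equiv.swap_apply_eq_iff, Equiv.swap_apply_right] at h; exact h)
    rw [h3, h2, Fin.sum_univ_four, Equiv.swap_apply_left, h4 1 (by decide), h4 2 (by decide),
      h4 3 (by decide)]
    simp [N, mulVec, dotProduct, Fin.sum_univ_four, nullForm]
    ring

theorem nullForm_eq_quad (ξ : Fin 4 → ℝ) :
    nullForm ξ = quad ![0, 1, 0, 0, 0, 0, 0, -1, 0, -1] ξ := by
  simp [nullForm, quad]; ring

theorem isQuad_nullForm : IsQuad nullForm := ⟨_, nullForm_eq_quad⟩

theorem IsQuad.comp_mulVec {Q : (Fin 4 → ℝ) → ℝ} (hQ : IsQuad Q) (f : Matrix (Fin 4) (Fin 4) ℝ) :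
    IsQuad fun ξ => Q (f *ᵥ ξ) := by
  obtain ⟨k, hk⟩ := hQ
  obtain ⟨B, -, hB⟩ := exists_matrix k
  obtain ⟨l, hl⟩ := exists_quad (fᵀ * B * f)
  refine ⟨l, fun ξ => ?_⟩
  beta_reduce
  rw [hk, hB, ← hl, ← mulVec_mulVec, ← mulVec_mulVec, dotProduct_mulVec ξ, vecMul_transpose]

theorem IsQuad.mul_eq_zero {Q R : (Fin 4 → ℝ) → ℝ} (hQ : IsQuad Q) (hR : IsQuad R)
    (h : ∀ ξ, Q ξ * R ξ = 0) : (∀ ξ, Q ξ = 0) ∨ ∀ ξ, R ξ = 0 := by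
  obtain ⟨k, hk⟩ := hQ
  obtain ⟨l, hl⟩ := hR
  simp only [hk, hl] at h ⊢
  exact (analyticOnNhd_quad k).eq_zero_or_eq_zero (analyticOnNhd_quad l) h

theorem IsQuad.eq_of_nullForm_mul {Q R : (Fin 4 → ℝ) → ℝ} (hQ : IsQuad Q) (hR : IsQuad R)
    (h : ∀ ξ, nullForm ξ * Q ξ = nullForm ξ * R ξ) (ξ : Fin 4 → ℝ) : Q ξ = R ξ := by
  have := isQuad_nullForm.mul_eq_zero (hQ.add (hR.const_mul (-1))) fun ξ => by
    linear_combination h ξ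
  rcases this with h | h
  · have := h ![1, 1, 0, 0]
    simp [nullForm] at this
  · linear_combination h ξ

theorem IsQuad.of_nullRay_mul {Q R : (Fin 4 → ℝ) → ℝ} (hQ : IsQuad Q) (hR : IsQuad R)
    (h : ∀ u v, Q (nullRay u v) * R (nullRay u v) = 0) :
    (∃ c, ∀ ξ, Q ξ = c * nullForm ξ) ∨ ∃ c, ∀ ξ, R ξ = c * nullForm ξ := by
  obtain ⟨k, hk⟩ := hQ
  obtain ⟨l, hl⟩ := hR
  simp only [hk, hl] at h ⊢
  exact (quad_mul_nullRay h).imp (fun h => ⟨_, h⟩) fun h => ⟨_, h⟩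

theorem nullForm_nullRay (u v : ℝ) : nullForm (nullRay u v) = 0 := by
  simp [nullForm, nullRay]

/-- The Fresnel polynomial of `A` is `nullForm` times a nondegenerate quadratic form that is not
proportional to `nullForm`. -/
def Factored (A : Matrix (Fin 6) (Fin 6) ℝ) : Prop :=
  A.IsSymm ∧ A.det ≠ 0 ∧ ∃ Q, IsQuad Q ∧ (∀ η, (∀ ξ, Q (ξ + η) = Q ξ) → η = 0) ∧
    (∀ ξ, fres A ξ = nullForm ξ * Q ξ) ∧ ¬∃ c, ∀ ξ, Q ξ = c * nullForm ξ

theorem Factored.pull_of_conformal {A : Matrix (Fin 6) (Fin 6) ℝ} (hA : Factored A)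
    {f : Matrix (Fin 4) (Fin 4) ℝ} (hf : f.det ≠ 0) {c : ℝ} (hc : c ≠ 0)
    (hfn : ∀ ξ, nullForm (f *ᵥ ξ) = c * nullForm ξ) : Factored (pull f A) := by
  obtain ⟨hs, hd, Q, hQ, hQn, hG, hQc⟩ := hA
  have hu : IsUnit f.det := isUnit_iff_ne_zero.2 hf
  have hff (ξ) : f *ᵥ f⁻¹ *ᵥ ξ = ξ := by rw [mulVec_mulVec, mul_nonsing_inv _ hu, one_mulVec]
  have hff' (ξ) : f⁻¹ *ᵥ f *ᵥ ξ = ξ := by rw [mulVec_mulVec, nonsing_inv_mul _ hu, one_mulVec]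
  have hd0 : |f.det|⁻¹ ≠ 0 := by simpa using hf
  refine ⟨pull_isSymm hs f, det_pull_ne hd hf, _,
    (hQ.comp_mulVec f).const_mul (|f.det|⁻¹ * c), fun η h => ?_, fun ξ => ?_, ?_⟩
  · have : f *ᵥ η = 0 := hQn _ fun ξ => by
      have := mul_left_cancel₀ (mul_ne_zero hd0 hc) (h (f⁻¹ *ᵥ ξ))
      rwa [mulVec_add, hff] at this
    rw [← hff' η, this, mulVec_zero]
  · rw [fres_pull hs hf, hG, hfn]; ring
  · rintro ⟨e, he⟩
    refine hQc ⟨|f.det| * e / c ^ 2, fun ξ => ?_⟩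
    have h1 := he (f⁻¹ *ᵥ ξ)
    have h2 := hfn (f⁻¹ *ᵥ ξ)
    rw [hff] at h1 h2
    have : |f.det| ≠ 0 := abs_ne_zero.2 hf
    rw [h2]
    field_simp at h1 ⊢
    linear_combination h1

theorem factored_of_zeros {A : Matrix (Fin 6) (Fin 6) ℝ} (hs : A.IsSymm) (hd : A.det ≠ 0)
    {γ : Matrix (Fin 4) (Fin 4) ℝ} (hγ : γ.IsSymm) (hγd : γ.det < 0)
    (hz : ∀ ξ, fres A ξ = 0 ↔ nullForm ξ = 0 ∨ ξ ⬝ᵥ γ *ᵥ ξ = 0)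
    (hne : ¬∀ ξ, nullForm ξ = 0 ↔ ξ ⬝ᵥ γ *ᵥ ξ = 0) : Factored A := by
  have hprop {c : ℝ} (h : ∀ ξ, ξ ⬝ᵥ γ *ᵥ ξ = c * nullForm ξ) (hc : c ≠ 0) : False :=
    hne fun ξ => by simp [h, hc]
  have hγn (η : Fin 4 → ℝ) (h : ∀ ξ, (ξ + η) ⬝ᵥ γ *ᵥ (ξ + η) = ξ ⬝ᵥ γ *ᵥ ξ) : η = 0 := by
    have h0 : η ⬝ᵥ γ *ᵥ η = 0 := by simpa using h 0
    have h1 (ξ) : ξ ⬝ᵥ γ *ᵥ η = 0 := by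
      have h2 := h ξ
      have h3 : η ⬝ᵥ γ *ᵥ ξ = ξ ⬝ᵥ γ *ᵥ η := by
        rw [dotProduct_mulVec, ← mulVec_transpose, hγ.eq, dotProduct_comm]
      simp only [mulVec_add, dotProduct_add, add_dotProduct] at h2
      linarith
    have h2 : γ *ᵥ η = 0 := by simpa using h1 (γ *ᵥ η)
    exact eq_zero_of_mulVec_eq_zero hγd.ne h2
  have hγ0 : ¬∀ ξ, ξ ⬝ᵥ γ *ᵥ ξ = 0 := fun h => by
    have := congrFun (hγn (Pi.single 0 1) fun ξ => by rw [h, h]) 0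
    simp at this
  obtain ⟨k, hk⟩ := (isReducible_fres A).exists_eq_mul fun ξ h => (hz ξ).2 (Or.inl h)
  obtain ⟨f, hf, c, hc, hfc⟩ := exists_nullForm_frame hγ hγd
  have hu : IsUnit f.det := isUnit_iff_ne_zero.2 hf
  have hff (ξ) : f *ᵥ f⁻¹ *ᵥ ξ = ξ := by rw [mulVec_mulVec, mul_nonsing_inv _ hu, one_mulVec]
  have hγf (ξ) : ξ ⬝ᵥ γ *ᵥ ξ = c * nullForm (f⁻¹ *ᵥ ξ) := by rw [← hfc, hff]
  have h1 := (isQuad_nullForm.comp_mulVec f).of_nullRay_mul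
    (IsQuad.comp_mulVec (Q := quad k) ⟨k, fun _ => rfl⟩ f) fun u v => by
      rw [← hk, hz, hfc, nullForm_nullRay]; simp
  rcases h1 with ⟨e, he⟩ | ⟨e, he⟩
  · have h2 (ξ) : nullForm ξ = e * nullForm (f⁻¹ *ᵥ ξ) := by rw [← he, hff]
    have he0 : e ≠ 0 := by
      rintro rfl
      have := h2 ![1, 1, 0, 0]
      simp [nullForm] at this
    exact (hprop (c := c / e) (fun ξ => by rw [hγf, h2 ξ]; field_simp) (div_ne_zero hc he0)).elim
  · have h2 (ξ) : quad k ξ = e / c * (ξ ⬝ᵥ γ *ᵥ ξ) := by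
      rw [hγf, ← mul_assoc, div_mul_cancel₀ _ hc, ← he, hff]
    have he0 : e ≠ 0 := by
      rintro rfl
      obtain ⟨l, hl⟩ := exists_quad γ
      have h3 : ∀ ξ, nullForm ξ * (ξ ⬝ᵥ γ *ᵥ ξ) = 0 := fun ξ =>
        mul_eq_zero.2 ((hz ξ).1 (by rw [hk, h2]; simp))
      rcases isQuad_nullForm.mul_eq_zero ⟨l, hl⟩ h3 with h | h
      · have := h ![1, 1, 0, 0]
        simp [nullForm] at this
      · exact hγ0 h
    have hec := div_ne_zero he0 hc
    refine ⟨hs, hd, _, ⟨k, fun _ => rfl⟩, fun η h => hγn η fun ξ => ?_, hk, ?_⟩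
    · have := h ξ
      rw [h2, h2] at this
      exact mul_left_cancel₀ hec this
    · rintro ⟨d, hd⟩
      have h3 (ξ) : ξ ⬝ᵥ γ *ᵥ ξ = d * c / e * nullForm ξ := by
        have := hd ξ
        rw [h2] at this
        field_simp at this ⊢
        linear_combination this
      by_cases hd0 : d = 0
      · exact hγ0 fun ξ => by rw [h3, hd0]; simp
      · exact hprop h3 (div_ne_zero (mul_ne_zero hd0 hc) he0)

theorem mem_nullCone {g : Matrix (Fin 4) (Fin 4) ℝ} {ξ : Fin 4 → ℝ} :
    ξ ∈ nullCone g ↔ ξ ⬝ᵥ g⁻¹ *ᵥ ξ = 0 := by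
  have : ∑ i, ∑ j, g⁻¹ i j * ξ i * ξ j = ξ ⬝ᵥ g⁻¹ *ᵥ ξ := by
    simp only [dotProduct, mulVec, Finset.mul_sum]
    exact Finset.sum_congr rfl fun _ _ => Finset.sum_congr rfl fun _ _ => by ring
  rw [nullCone, Set.mem_ofPred_eq, this]

theorem exists_factored_pull {A : Matrix (Fin 6) (Fin 6) ℝ} (hs : A.IsSymm) (hd : A.det ≠ 0)
    (h : DoubleCone (medium A)) :
    ∃ f : Matrix (Fin 4) (Fin 4) ℝ, f.det ≠ 0 ∧ Factored (pull f A) := by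
  obtain ⟨gp, gm, ⟨hps, hpd⟩, ⟨hms, hmd⟩, hne, hz⟩ := h
  have hinv {g : Matrix (Fin 4) (Fin 4) ℝ} (h : g.det < 0) : g⁻¹.det < 0 := by
    rw [det_nonsing_inv, Ring.inverse_eq_inv']
    exact inv_lt_zero.2 h
  have hinvs {g : Matrix (Fin 4) (Fin 4) ℝ} (h : g.IsSymm) : g⁻¹.IsSymm := by
    rw [IsSymm, transpose_nonsing_inv, h.eq]
  obtain ⟨f, hf, c, hc, hfc⟩ := exists_nullForm_frame (hinvs hps) (hinv hpd)
  have hu : IsUnit f.det := isUnit_iff_ne_zero.2 hf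
  have hff (ξ) : f *ᵥ f⁻¹ *ᵥ ξ = ξ := by rw [mulVec_mulVec, mul_nonsing_inv _ hu, one_mulVec]
  have h1 (ξ) : nullForm ξ = 0 ↔ f *ᵥ ξ ∈ nullCone gp := by
    rw [mem_nullCone, hfc]; simp [hc]
  have h2 (ξ) : ξ ⬝ᵥ (fᵀ * gm⁻¹ * f) *ᵥ ξ = 0 ↔ f *ᵥ ξ ∈ nullCone gm := by
    rw [mem_nullCone, ← mulVec_mulVec, ← mulVec_mulVec, dotProduct_mulVec ξ, vecMul_transpose]
  have h3 (ξ) : fres A ξ = 0 ↔ ξ ∈ nullCone gp ∨ ξ ∈ nullCone gm := by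
    rw [← fresnel_medium hs, ← Set.mem_union, ← hz, Set.mem_ofPred_eq]
  refine ⟨f, hf, factored_of_zeros (pull_isSymm hs f) (det_pull_ne hd hf) (γ := fᵀ * gm⁻¹ * f)
    ?_ ?_ (fun ξ => ?_) fun h => hne ?_⟩
  · rw [IsSymm, transpose_mul, transpose_mul, transpose_transpose, (hinvs hms).eq,
      Matrix.mul_assoc]
  · rw [det_mul, det_mul, det_transpose]
    have := hinv hmd
    have h4 : 0 < f.det ^ 2 := by positivity
    nlinarith
  · rw [h1, h2, ← h3, fres_pull hs hf]
    simp [hf]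
  · ext ξ
    have := h (f⁻¹ *ᵥ ξ)
    rwa [h1, h2, hff] at this

theorem wedge_add_smul_left (x y z : Fin 4 → ℝ) (s : ℝ) :
    wedge (x + s • y) z = wedge x z + s • wedge y z := by
  funext I; fin_cases I <;> simp [wedge] <;> ring

theorem wedge_add_smul_right (x y z : Fin 4 → ℝ) (s : ℝ) :
    wedge x (y + s • z) = wedge x y + s • wedge x z := by
  funext I; fin_cases I <;> simp [wedge] <;> ring

theorem wedge_self (x : Fin 4 → ℝ) : wedge x x = 0 := by
  funext I; fin_cases I <;> simp [wedge] <;> ring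

theorem dotProduct_mulVec_comm {n : Type*} [Fintype n] {A : Matrix n n ℝ} (hA : A.IsSymm)
    (x y : n → ℝ) : x ⬝ᵥ A *ᵥ y = y ⬝ᵥ A *ᵥ x := by
  rw [dotProduct_mulVec, ← mulVec_transpose, hA.eq, dotProduct_comm]

/-- Derivative of `nullRay` in the first parameter. -/
def rayFst (u : ℝ) : Fin 4 → ℝ := ![0, 2 * u, 1, 0]

/-- Derivative of `nullRay` in the second parameter. -/
def raySnd (v : ℝ) : Fin 4 → ℝ := ![0, 2 * v, 0, 1]

/-- Gram determinant of the null plane elements along `nullRay`. -/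
def rayDet (A : Matrix (Fin 6) (Fin 6) ℝ) (u v : ℝ) : ℝ :=
  (wedge (nullRay u v) (rayFst u) ⬝ᵥ A *ᵥ wedge (nullRay u v) (rayFst u)) *
      (wedge (nullRay u v) (raySnd v) ⬝ᵥ A *ᵥ wedge (nullRay u v) (raySnd v)) -
    (wedge (nullRay u v) (rayFst u) ⬝ᵥ A *ᵥ wedge (nullRay u v) (raySnd v)) ^ 2

theorem eq_zero_of_rayDet_ne_zero {A : Matrix (Fin 6) (Fin 6) ℝ} (hA : A.IsSymm)
    {Q : (Fin 4 → ℝ) → ℝ} (hQ : Continuous Q) (hG : ∀ ξ, fres A ξ = nullForm ξ * Q ξ) {u v : ℝ}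
    (h : rayDet A u v ≠ 0) : Q (nullRay u v) = 0 := by
  rw [rayDet] at h
  set ξ := nullRay u v with hξ
  set a₁ := wedge ξ (rayFst u) with ha₁
  set a₂ := wedge ξ (raySnd v) with ha₂
  set n : Fin 4 → ℝ := ![0, 1, 0, 0] with hn
  set r₁ := a₁ ⬝ᵥ A *ᵥ wedge ξ n with hr₁
  set r₂ := a₂ ⬝ᵥ A *ᵥ wedge ξ n with hr₂
  set D := (a₁ ⬝ᵥ A *ᵥ a₁) * (a₂ ⬝ᵥ A *ᵥ a₂) - (a₁ ⬝ᵥ A *ᵥ a₂) ^ 2 with hD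
  set k₁ := (r₂ * (a₁ ⬝ᵥ A *ᵥ a₂) - r₁ * (a₂ ⬝ᵥ A *ᵥ a₂)) / D with hk₁
  set k₂ := (r₁ * (a₁ ⬝ᵥ A *ᵥ a₂) - r₂ * (a₁ ⬝ᵥ A *ᵥ a₁)) / D with hk₂
  set η := n + k₁ • rayFst u + k₂ • raySnd v with hη
  set d := wedge ξ η with hd
  have hd' : d = wedge ξ n + k₁ • a₁ + k₂ • a₂ := by
    rw [hd, hη, wedge_add_smul_right, wedge_add_smul_right]
  have hsymm := dotProduct_mulVec_comm hA
  have h1 : a₁ ⬝ᵥ A *ᵥ d = 0 := by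
    rw [hd']
    simp only [mulVec_add, mulVec_smul, dotProduct_add, dotProduct_smul, smul_eq_mul, ← hr₁]
    rw [hk₁, hk₂]
    field_simp
    rw [hD]; ring
  have h2 : a₂ ⬝ᵥ A *ᵥ d = 0 := by
    rw [hd']
    simp only [mulVec_add, mulVec_smul, dotProduct_add, dotProduct_smul, smul_eq_mul, ← hr₂]
    rw [hsymm a₂ a₁, hk₁, hk₂]
    field_simp
    rw [hD]; ring
  have hdet (s : ℝ) : (Matrix.of (Fin.cons (ξ + s • η) ![rayFst u, raySnd v, η] :
      Fin 4 → Fin 4 → ℝ)).det = 1 := by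
    simp [det_succ_row_zero, Fin.sum_univ_succ, Fin.succAbove, hξ, hη, nullRay, rayFst, raySnd,
      hn]
    ring
  have hnull (s : ℝ) : nullForm (ξ + s • η) = s - s ^ 2 * (k₁ ^ 2 + k₂ ^ 2) := by
    simp [hξ, hη, nullRay, rayFst, raySnd, hn, nullForm]
    ring
  set m := d ⬝ᵥ A *ᵥ d
  set e₁ := wedge η (rayFst u)
  set e₂ := wedge η (raySnd v)
  set G₁₁ : ℝ → ℝ := fun s => (a₁ + s • e₁) ⬝ᵥ A *ᵥ (a₁ + s • e₁) with hG₁₁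
  set G₁₂ : ℝ → ℝ := fun s => (a₁ + s • e₁) ⬝ᵥ A *ᵥ (a₂ + s • e₂) with hG₁₂
  set G₂₂ : ℝ → ℝ := fun s => (a₂ + s • e₂) ⬝ᵥ A *ᵥ (a₂ + s • e₂) with hG₂₂
  set p₁ := e₁ ⬝ᵥ A *ᵥ d with hp₁
  set p₂ := e₂ ⬝ᵥ A *ᵥ d with hp₂
  have key (s : ℝ) : (s - s ^ 2 * (k₁ ^ 2 + k₂ ^ 2)) * Q (ξ + s • η) =
      m * (G₁₁ s * G₂₂ s - G₁₂ s ^ 2) -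
        s ^ 2 * (p₁ ^ 2 * G₂₂ s - 2 * p₁ * p₂ * G₁₂ s + p₂ ^ 2 * G₁₁ s) := by
    have hw := det_wedgeGram hA (ξ + s • η) ![rayFst u, raySnd v, η]
    have hb₁ : wedge (ξ + s • η) (rayFst u) = a₁ + s • e₁ := wedge_add_smul_left _ _ _ _
    have hb₂ : wedge (ξ + s • η) (raySnd v) = a₂ + s • e₂ := wedge_add_smul_left _ _ _ _
    have hb₃ : wedge (ξ + s • η) η = d := by
      rw [wedge_add_smul_left, wedge_self, smul_zero, add_zero]
    have hc₁ : (a₁ + s • e₁) ⬝ᵥ A *ᵥ d = s * p₁ := by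
      rw [add_dotProduct, h1, smul_dotProduct, smul_eq_mul, zero_add]
    have hc₂ : (a₂ + s • e₂) ⬝ᵥ A *ᵥ d = s * p₂ := by
      rw [add_dotProduct, h2, smul_dotProduct, smul_eq_mul, zero_add]
    rw [hdet, one_pow, one_mul, hG, hnull] at hw
    rw [← hw, det_fin_three]
    simp only [wedgeGram, of_apply, cons_val, hb₁, hb₂, hb₃, hc₁, hc₂, hsymm d,
      hsymm (a₂ + s • e₂) (a₁ + s • e₁)]
    simp only [hG₁₁, hG₁₂, hG₂₂]
    ring
  have hm : m = 0 := by
    have := key 0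
    simp only [hG₁₁, hG₁₂, hG₂₂, zero_smul, add_zero, ← hD] at this
    have h3 : m * D = 0 := by linarith
    exact (mul_eq_zero.1 h3).resolve_right h
  have hc : ∀ x y x' y' : Fin 6 → ℝ,
      Continuous fun s : ℝ => (x + s • y) ⬝ᵥ A *ᵥ (x' + s • y') := fun x y x' y' =>
    Continuous.dotProduct (by fun_prop) (continuous_const.matrix_mulVec (by fun_prop))
  have hext := Continuous.ext_on (dense_compl_singleton (0 : ℝ))
    (f := fun s => (1 - s * (k₁ ^ 2 + k₂ ^ 2)) * Q (ξ + s • η))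
    (g := fun s => -s * (p₁ ^ 2 * G₂₂ s - 2 * p₁ * p₂ * G₁₂ s + p₂ ^ 2 * G₁₁ s))
    (by fun_prop) (by
      have := hc a₁ e₁ a₁ e₁
      have := hc a₁ e₁ a₂ e₂
      have := hc a₂ e₂ a₂ e₂
      fun_prop) fun s hs => by
        refine mul_left_cancel₀ (show s ≠ 0 from hs) ?_
        have := key s
        rw [hm] at this
        linear_combination this
  simpa using congrFun hext 0

theorem Factored.rayDet_eq_zero {A : Matrix (Fin 6) (Fin 6) ℝ} (hA : Factored A) (u v : ℝ) :
    rayDet A u v = 0 := by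
  obtain ⟨hs, -, Q, ⟨k, hk⟩, -, hG, hQ⟩ := hA
  have hQc : Continuous Q := by
    rw [show Q = quad k from funext hk]; unfold quad; fun_prop
  have hray : AnalyticOnNhd ℝ (fun p : ℝ × ℝ => rayDet A p.1 p.2) Set.univ := by
    have : ContDiff ℝ ⊤ fun p : ℝ × ℝ => rayDet A p.1 p.2 := by
      simp only [rayDet, dotProduct, mulVec, wedge, nullRay, rayFst, raySnd, Fin.sum_univ_six,
        cons_val]
      fun_prop
    exact this.analyticOnNhd
  rcases hray.eq_zero_or_eq_zero (analyticOnNhd_quad_nullRay k) fun p => by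
    by_cases h : rayDet A p.1 p.2 = 0
    · rw [h, zero_mul]
    · rw [← hk, eq_zero_of_rayDet_ne_zero hs hQc hG h, mul_zero] with h | h
  · exact h (u, v)
  · exact (hQ ⟨k 1, fun ξ => (hk ξ).trans (quad_eq_nullForm (fun u v => h (u, v)) ξ)⟩).elim

/-- Coefficients of `S₁₁ - S₂₂ + 2 i S₁₂`, where `S` is the Gram matrix of the null plane elements
along `nullRay u v`, as a polynomial in `u + iv`. -/
def holCoeff (A : Matrix (Fin 6) (Fin 6) ℝ) : Fin 5 → ℂ :=
  ![⟨A 1 1 - A 2 2, 2 * A 1 2⟩, ⟨4 * A 0 1 - 2 * A 2 3, 2 * A 1 3 + 4 * A 0 2⟩,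
    ⟨2 * (A 2 4 - A 1 5) + 4 * A 0 0 - A 3 3, 4 * A 0 3 - 2 * (A 1 4 + A 2 5)⟩,
    ⟨2 * A 3 4 - 4 * A 0 5, -(4 * A 0 4) - 2 * A 3 5⟩, ⟨A 5 5 - A 4 4, 2 * A 4 5⟩]

/-- Coefficients of `S₁₁ + S₂₂` as a polynomial in `u + iv` and `u - iv`. -/
def mixCoeff (A : Matrix (Fin 6) (Fin 6) ℝ) : Matrix (Fin 3) (Fin 3) ℂ :=
  !![⟨A 1 1 + A 2 2, 0⟩, ⟨2 * A 0 1 + A 2 3, 2 * A 0 2 - A 1 3⟩, ⟨-A 1 5 - A 2 4, A 1 4 - A 2 5⟩;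
    ⟨2 * A 0 1 + A 2 3, A 1 3 - 2 * A 0 2⟩, ⟨4 * A 0 0 + A 3 3, 0⟩,
      ⟨-(2 * A 0 5) - A 3 4, 2 * A 0 4 - A 3 5⟩;
    ⟨-A 1 5 - A 2 4, A 2 5 - A 1 4⟩, ⟨-(2 * A 0 5) - A 3 4, A 3 5 - 2 * A 0 4⟩,
      ⟨A 4 4 + A 5 5, 0⟩]

/-- The quartic polynomial with given coefficients. -/
def quartic (w : Fin 5 → ℂ) (a : ℂ) : ℂ := w 0 + w 1 * a + w 2 * a ^ 2 + w 3 * a ^ 3 + w 4 * a ^ 4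

/-- The polynomial of bidegree `(2, 2)` with given coefficients. -/
def biquadratic (H : Matrix (Fin 3) (Fin 3) ℂ) (a b : ℂ) : ℂ :=
  (H 0 0 + H 0 1 * b + H 0 2 * b ^ 2) + (H 1 0 + H 1 1 * b + H 1 2 * b ^ 2) * a +
    (H 2 0 + H 2 1 * b + H 2 2 * b ^ 2) * a ^ 2

theorem isSymm_swap {A : Matrix (Fin 6) (Fin 6) ℝ} (hA : A.IsSymm) :
    A 1 0 = A 0 1 ∧ A 2 0 = A 0 2 ∧ A 3 0 = A 0 3 ∧ A 4 0 = A 0 4 ∧ A 5 0 = A 0 5 ∧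
    A 2 1 = A 1 2 ∧ A 3 1 = A 1 3 ∧ A 4 1 = A 1 4 ∧ A 5 1 = A 1 5 ∧ A 3 2 = A 2 3 ∧
    A 4 2 = A 2 4 ∧ A 5 2 = A 2 5 ∧ A 4 3 = A 3 4 ∧ A 5 3 = A 3 5 ∧ A 5 4 = A 4 5 :=
  ⟨hA.apply _ _, hA.apply _ _, hA.apply _ _, hA.apply _ _, hA.apply _ _, hA.apply _ _,
    hA.apply _ _, hA.apply _ _, hA.apply _ _, hA.apply _ _, hA.apply _ _, hA.apply _ _,
    hA.apply _ _, hA.apply _ _, hA.apply _ _⟩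

theorem quartic_holCoeff {A : Matrix (Fin 6) (Fin 6) ℝ} (hA : A.IsSymm) (t : ℂ) :
    quartic (holCoeff A) t =
      ⟨wedge (nullRay t.re t.im) (rayFst t.re) ⬝ᵥ A *ᵥ wedge (nullRay t.re t.im) (rayFst t.re) -
        wedge (nullRay t.re t.im) (raySnd t.im) ⬝ᵥ A *ᵥ wedge (nullRay t.re t.im) (raySnd t.im),
      2 * (wedge (nullRay t.re t.im) (rayFst t.re) ⬝ᵥ
        A *ᵥ wedge (nullRay t.re t.im) (raySnd t.im))⟩ := by
  obtain ⟨h1, h2, h3, h4, h5, h6, h7, h8, h9, h10, h11, h12, h13, h14, h15⟩ := isSymm_swap hA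
  apply Complex.ext <;>
  · simp only [quartic, holCoeff, cons_val, pow_succ, pow_zero, one_mul, Complex.add_re,
      Complex.add_im, Complex.mul_re, Complex.mul_im, wedge, nullRay, rayFst, raySnd, dotProduct,
      mulVec, Fin.sum_univ_six, h1, h2, h3, h4, h5, h6, h7, h8, h9, h10, h11, h12, h13, h14, h15]
    ring

theorem biquadratic_mixCoeff {A : Matrix (Fin 6) (Fin 6) ℝ} (hA : A.IsSymm) (t : ℂ) :
    biquadratic (mixCoeff A) t (starRingEnd ℂ t) =
      ⟨wedge (nullRay t.re t.im) (rayFst t.re) ⬝ᵥ A *ᵥ wedge (nullRay t.re t.im) (rayFst t.re) +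
        wedge (nullRay t.re t.im) (raySnd t.im) ⬝ᵥ A *ᵥ wedge (nullRay t.re t.im) (raySnd t.im),
      0⟩ := by
  obtain ⟨h1, h2, h3, h4, h5, h6, h7, h8, h9, h10, h11, h12, h13, h14, h15⟩ := isSymm_swap hA
  apply Complex.ext <;>
  · simp only [biquadratic, mixCoeff, of_apply, cons_val, cons_val', pow_succ, pow_zero, one_mul,
      Complex.add_re,
      Complex.add_im, Complex.mul_re, Complex.mul_im, Complex.conj_re, Complex.conj_im, wedge,
      nullRay, rayFst, raySnd, dotProduct,
      mulVec, Fin.sum_univ_six, h1, h2, h3, h4, h5, h6, h7, h8, h9, h10, h11, h12, h13, h14, h15]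
    ring

theorem conj_quartic (w : Fin 5 → ℂ) (a : ℂ) :
    starRingEnd ℂ (quartic w a) = quartic (fun i => starRingEnd ℂ (w i)) (starRingEnd ℂ a) := by
  simp [quartic]

theorem eq_zero_of_forall_real {f : ℂ → ℂ} (hf : Differentiable ℂ f) (h : ∀ x : ℝ, f x = 0) (z : ℂ) :
    f z = 0 := by
  have h0 : ∃ᶠ z in nhdsWithin (0 : ℂ) {0}ᶜ, f z = 0 := by
    have ht : Filter.Tendsto (fun x : ℝ => (x : ℂ)) (nhdsWithin (0 : ℝ) {0}ᶜ)
        (nhdsWithin (0 : ℂ) {0}ᶜ) := by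
      refine tendsto_nhdsWithin_iff.2 ⟨?_, ?_⟩
      · exact (Complex.continuous_ofReal.tendsto' 0 0 Complex.ofReal_zero).mono_left
          nhdsWithin_le_nhds
      · filter_upwards [self_mem_nhdsWithin] with x hx
        simpa using hx
    exact ht.frequently (Filter.Frequently.of_forall h)
  exact (hf.differentiableOn.analyticOnNhd isOpen_univ).eqOn_zero_of_preconnected_of_frequently_eq_zero
    isPreconnected_univ (Set.mem_univ 0) h0 (Set.mem_univ z)

theorem eq_zero_of_forall_conj {P : ℂ → ℂ → ℂ} (hP : Differentiable ℂ fun p : ℂ × ℂ => P p.1 p.2)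
    (h : ∀ t, P t (starRingEnd ℂ t) = 0) (a b : ℂ) : P a b = 0 := by
  have h1 (u : ℝ) (z : ℂ) : P (u + Complex.I * z) (u - Complex.I * z) = 0 := by
    refine eq_zero_of_forall_real (f := fun z : ℂ => P (u + Complex.I * z) (u - Complex.I * z))
      (hP.comp (f := fun z : ℂ => ((u : ℂ) + Complex.I * z, (u : ℂ) - Complex.I * z))
        (by fun_prop)) (fun v => ?_) z
    convert h (u + Complex.I * v) using 2
    simp [sub_eq_add_neg]
  have h2 (w z : ℂ) : P (w + Complex.I * z) (w - Complex.I * z) = 0 :=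
    eq_zero_of_forall_real (f := fun w : ℂ => P (w + Complex.I * z) (w - Complex.I * z))
      (hP.comp (f := fun w : ℂ => (w + Complex.I * z, w - Complex.I * z))
        (by fun_prop)) (fun u => h1 u z) w
  convert h2 ((a + b) / 2) (-(Complex.I * (a - b) / 2)) using 2
  · linear_combination ((a - b) / 2) * Complex.I_sq
  · linear_combination (-(a - b) / 2) * Complex.I_sq

theorem Factored.sq_biquadratic {A : Matrix (Fin 6) (Fin 6) ℝ} (hA : Factored A) (a b : ℂ) :
    biquadratic (mixCoeff A) a b ^ 2 = quartic (holCoeff A) a *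
      quartic (fun i => starRingEnd ℂ (holCoeff A i)) b := by
  refine sub_eq_zero.1 (eq_zero_of_forall_conj (P := fun a b =>
    biquadratic (mixCoeff A) a b ^ 2 - quartic (holCoeff A) a *
      quartic (fun i => starRingEnd ℂ (holCoeff A i)) b) ?_ (fun t => ?_) a b)
  · unfold biquadratic quartic
    fun_prop
  · have h := hA.rayDet_eq_zero t.re t.im
    rw [← conj_quartic, quartic_holCoeff hA.1, biquadratic_mixCoeff hA.1]
    rw [rayDet] at h
    apply Complex.ext
    · simp [pow_two]
      linear_combination 4 * h
    · simp [pow_two]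
      ring

theorem quartic_eq_zero {c : Fin 5 → ℂ} (h : ∀ a, quartic c a = 0) (i : Fin 5) : c i = 0 := by
  simp only [quartic] at h
  have h0 := h 0
  have h1 := h 1
  have h2 := h (-1)
  have h3 := h 2
  have h4 := h (-2)
  norm_num at h0 h1 h2 h3 h4
  fin_cases i
  · exact h0
  · show c 1 = 0
    linear_combination (2 / 3) * (h1 - h2) - (1 / 12) * (h3 - h4)
  · show c 2 = 0
    linear_combination (2 / 3) * (h1 + h2) - (1 / 24) * (h3 + h4) - (5 / 4) * h0
  · show c 3 = 0
    linear_combination (1 / 12) * (h3 - h4) - (1 / 6) * (h1 - h2)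
  · show c 4 = 0
    linear_combination (1 / 24) * (h3 + h4) - (1 / 6) * (h1 + h2) + (1 / 4) * h0

theorem wedge_pull_wedge (f : Matrix (Fin 4) (Fin 4) ℝ) (A : Matrix (Fin 6) (Fin 6) ℝ)
    (ξ η ζ θ : Fin 4 → ℝ) :
    wedge ξ η ⬝ᵥ pull f A *ᵥ wedge ζ θ =
      |f.det|⁻¹ * (wedge (f *ᵥ ξ) (f *ᵥ η) ⬝ᵥ A *ᵥ wedge (f *ᵥ ζ) (f *ᵥ θ)) := by
  rw [← compound_mulVec_wedge, ← compound_mulVec_wedge, pull, smul_mulVec, dotProduct_smul,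
    smul_eq_mul, ← mulVec_mulVec, ← mulVec_mulVec, mulVec_transpose,
    dotProduct_comm (wedge ξ η), ← dotProduct_mulVec, dotProduct_comm (A *ᵥ _)]

/-- The frame preserving `nullForm` that translates `nullRay` by `t`. -/
def shift (t : ℂ) : Matrix (Fin 4) (Fin 4) ℝ :=
  !![1, 0, 0, 0; t.re ^ 2 + t.im ^ 2, 1, 2 * t.re, 2 * t.im; t.re, 0, 1, 0; t.im, 0, 0, 1]

theorem det_shift (t : ℂ) : (shift t).det = 1 := by
  simp [shift, det_succ_row_zero, Fin.sum_univ_succ, Fin.succAbove]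

theorem Factored.pull_shift {A : Matrix (Fin 6) (Fin 6) ℝ} (hA : Factored A) (t : ℂ) :
    Factored (pull (shift t) A) := by
  refine hA.pull_of_conformal (by rw [det_shift]; exact one_ne_zero) one_ne_zero fun ξ => ?_
  simp [shift, nullForm, mulVec, dotProduct, Fin.sum_univ_four]
  ring

theorem quartic_pull_shift {A : Matrix (Fin 6) (Fin 6) ℝ} (hA : A.IsSymm) (t s : ℂ) :
    quartic (holCoeff (pull (shift t) A)) s = quartic (holCoeff A) (s + t) := by
  have h1 : shift t *ᵥ nullRay s.re s.im = nullRay (s + t).re (s + t).im := by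
    funext i
    fin_cases i <;> simp [shift, nullRay, mulVec, dotProduct, Fin.sum_univ_four] <;> ring
  have h2 : shift t *ᵥ rayFst s.re = rayFst (s + t).re := by
    funext i
    fin_cases i <;> simp [shift, rayFst, mulVec, dotProduct, Fin.sum_univ_four]
    ring
  have h3 : shift t *ᵥ raySnd s.im = raySnd (s + t).im := by
    funext i
    fin_cases i <;> simp [shift, raySnd, mulVec, dotProduct, Fin.sum_univ_four]
    ring
  rw [quartic_holCoeff (pull_isSymm hA _), quartic_holCoeff hA]
  simp only [wedge_pull_wedge, h1, h2, h3, det_shift, abs_one, inv_one, one_mul]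

/-- The frame exchanging the two null directions `e₀` and `e₁`. -/
def swapNull : Matrix (Fin 4) (Fin 4) ℝ := !![0, 1, 0, 0; 1, 0, 0, 0; 0, 0, 1, 0; 0, 0, 0, 1]

theorem det_swapNull : swapNull.det = -1 := by
  simp [swapNull, det_succ_row_zero, Fin.sum_univ_succ, Fin.succAbove]

theorem compound_swapNull : compound swapNull =
    !![-1, 0, 0, 0, 0, 0; 0, 0, 0, 0, 0, 1; 0, 0, 0, 0, -1, 0; 0, 0, 0, 1, 0, 0;
      0, 0, -1, 0, 0, 0; 0, 1, 0, 0, 0, 0] := by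
  ext i j
  fin_cases i <;> fin_cases j <;> simp [compound, pairs, swapNull]

theorem Factored.pull_swapNull {A : Matrix (Fin 6) (Fin 6) ℝ} (hA : Factored A) :
    Factored (pull swapNull A) := by
  refine hA.pull_of_conformal (by rw [det_swapNull]; norm_num) one_ne_zero fun ξ => ?_
  simp [swapNull, nullForm, mulVec, dotProduct, Fin.sum_univ_four]
  ring

theorem holCoeff_pull_swapNull {A : Matrix (Fin 6) (Fin 6) ℝ} (hA : A.IsSymm)
    (h : holCoeff A 0 = 0) : holCoeff (pull swapNull A) 4 = 0 := by
  have h1 := congrArg Complex.re h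
  have h2 := congrArg Complex.im h
  have h3 := hA.apply 1 2
  simp [holCoeff] at h1 h2
  apply Complex.ext
  · simp [holCoeff, pull, det_swapNull, compound_swapNull, mul_apply, Fin.sum_univ_six]
    linear_combination h1
  · simp [holCoeff, pull, det_swapNull, compound_swapNull, mul_apply, Fin.sum_univ_six]
    linear_combination h2 + h3

theorem Factored.coeff_mul_quartic {A : Matrix (Fin 6) (Fin 6) ℝ} (hA : Factored A) (b : ℂ) :
    let P : Fin 3 → ℂ := fun i => mixCoeff A i 0 + mixCoeff A i 1 * b + mixCoeff A i 2 * b ^ 2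
    let W := quartic (fun i => starRingEnd ℂ (holCoeff A i)) b
    P 0 ^ 2 = holCoeff A 0 * W ∧ 2 * P 0 * P 1 = holCoeff A 1 * W ∧
      2 * P 0 * P 2 + P 1 ^ 2 = holCoeff A 2 * W ∧ 2 * P 1 * P 2 = holCoeff A 3 * W ∧
      P 2 ^ 2 = holCoeff A 4 * W := by
  intro P W
  have h := quartic_eq_zero (c := ![P 0 ^ 2 - holCoeff A 0 * W, 2 * P 0 * P 1 - holCoeff A 1 * W,
    2 * P 0 * P 2 + P 1 ^ 2 - holCoeff A 2 * W, 2 * P 1 * P 2 - holCoeff A 3 * W,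
    P 2 ^ 2 - holCoeff A 4 * W]) fun a => by
      have := hA.sq_biquadratic a b
      simp only [biquadratic, quartic, cons_val, P, W] at this ⊢
      linear_combination this
  exact ⟨sub_eq_zero.1 (h 0), sub_eq_zero.1 (h 1), sub_eq_zero.1 (h 2), sub_eq_zero.1 (h 3),
    sub_eq_zero.1 (h 4)⟩

theorem eq_zero_of_forall_quadratic {c₀ c₁ c₂ : ℂ} (h : ∀ b, c₀ + c₁ * b + c₂ * b ^ 2 = 0) :
    c₀ = 0 ∧ c₁ = 0 ∧ c₂ = 0 := by
  have h' := quartic_eq_zero (c := ![c₀, c₁, c₂, 0, 0]) fun b => by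
    simp only [quartic, cons_val]
    linear_combination h b
  exact ⟨h' 0, h' 1, h' 2⟩

theorem eq_zero_of_mul_conj_quartic {w : Fin 5 → ℂ} {i : Fin 5}
    (h : ∀ b, w i * quartic (fun i => starRingEnd ℂ (w i)) b = 0) : w i = 0 := by
  have h' := quartic_eq_zero (c := fun j => w i * starRingEnd ℂ (w j)) (fun b => by
    rw [← h b]; simp only [quartic]; ring) i
  simpa using h'

theorem Factored.eq_zero_of_holCoeff_zero {A : Matrix (Fin 6) (Fin 6) ℝ} (hA : Factored A)
    (h : holCoeff A 0 = 0) : mixCoeff A 0 0 = 0 ∧ mixCoeff A 0 1 = 0 ∧ mixCoeff A 0 2 = 0 ∧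
      holCoeff A 1 = 0 := by
  have h0 (b) : mixCoeff A 0 0 + mixCoeff A 0 1 * b + mixCoeff A 0 2 * b ^ 2 = 0 :=
    pow_eq_zero_iff two_ne_zero |>.1 <| by rw [(hA.coeff_mul_quartic b).1, h, zero_mul]
  obtain ⟨h1, h2, h3⟩ := eq_zero_of_forall_quadratic h0
  refine ⟨h1, h2, h3, eq_zero_of_mul_conj_quartic fun b => ?_⟩
  rw [← (hA.coeff_mul_quartic b).2.1]
  simp only [h0]
  ring

theorem Factored.eq_zero_of_holCoeff_four {A : Matrix (Fin 6) (Fin 6) ℝ} (hA : Factored A)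
    (h : holCoeff A 4 = 0) : mixCoeff A 2 0 = 0 ∧ mixCoeff A 2 1 = 0 ∧ mixCoeff A 2 2 = 0 ∧
      holCoeff A 3 = 0 := by
  have h0 (b) : mixCoeff A 2 0 + mixCoeff A 2 1 * b + mixCoeff A 2 2 * b ^ 2 = 0 :=
    pow_eq_zero_iff two_ne_zero |>.1 <| by
      rw [(hA.coeff_mul_quartic b).2.2.2.2, h, zero_mul]
  obtain ⟨h1, h2, h3⟩ := eq_zero_of_forall_quadratic h0
  refine ⟨h1, h2, h3, eq_zero_of_mul_conj_quartic fun b => ?_⟩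
  rw [← (hA.coeff_mul_quartic b).2.2.2.1]
  simp only [h0]
  ring

theorem exists_quartic_eq_zero {w : Fin 5 → ℂ} (h : w 4 ≠ 0) : ∃ t, quartic w t = 0 := by
  open Polynomial in
  obtain ⟨t, ht⟩ := Complex.exists_root
    (f := C (w 4) * X ^ 4 + (C (w 3) * X ^ 3 + C (w 2) * X ^ 2 + C (w 1) * X + C (w 0))) (by
      rw [degree_add_eq_left_of_degree_lt] <;> rw [degree_C_mul_X_pow 4 h]
      · norm_num
      · exact degree_cubic_lt)
  refine ⟨t, ?_⟩
  rw [← ht]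
  simp [quartic]
  ring

theorem exists_quartic_eq_zero_of_quadratic {w : Fin 5 → ℂ} (h : w 2 ≠ 0) (h3 : w 3 = 0)
    (h4 : w 4 = 0) : ∃ t, quartic w t = 0 := by
  open Polynomial in
  obtain ⟨t, ht⟩ := Complex.exists_root
    (f := C (w 2) * X ^ 2 + C (w 1) * X + C (w 0)) (by rw [degree_quadratic h]; norm_num)
  refine ⟨t, ?_⟩
  rw [← ht]
  simp [quartic, h3, h4]
  ring

theorem Factored.exists_pull_holCoeff_four {A : Matrix (Fin 6) (Fin 6) ℝ} (hA : Factored A) :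
    ∃ f : Matrix (Fin 4) (Fin 4) ℝ, f.det ≠ 0 ∧ Factored (pull f A) ∧
      holCoeff (pull f A) 4 = 0 := by
  by_cases h : holCoeff A 4 = 0
  · refine ⟨shift 0, by rw [det_shift]; exact one_ne_zero, hA.pull_shift 0, ?_⟩
    have := quartic_eq_zero (c := holCoeff (pull (shift 0) A) - holCoeff A) (fun a => by
      have := quartic_pull_shift hA.1 0 a
      simp only [quartic, add_zero, Pi.sub_apply] at this ⊢
      linear_combination this) 4
    exact (sub_eq_zero.1 this).trans h
  · obtain ⟨t, ht⟩ := exists_quartic_eq_zero h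
    have h0 : holCoeff (pull (shift t) A) 0 = 0 := by
      have := quartic_pull_shift hA.1 t 0
      rw [zero_add, ht] at this
      simpa [quartic] using this
    refine ⟨shift t * swapNull, by rw [det_mul, det_shift, det_swapNull]; norm_num, ?_, ?_⟩
    · rw [← pull_mul]
      exact (hA.pull_shift t).pull_swapNull
    · rw [← pull_mul]
      exact holCoeff_pull_swapNull (pull_isSymm hA.1 _) h0

theorem quartic_shift_coeff_four {w w' : Fin 5 → ℂ} {t : ℂ} (h3 : w 3 = 0) (h4 : w 4 = 0)
    (h : ∀ a, quartic w' a = quartic w (a + t)) : w' 4 = 0 := by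
  refine quartic_eq_zero (c := ![w' 0 - (w 0 + w 1 * t + w 2 * t ^ 2),
    w' 1 - (w 1 + 2 * w 2 * t), w' 2 - w 2, w' 3, w' 4]) (fun a => ?_) 4
  have := h a
  simp only [quartic, h3, h4, cons_val] at this ⊢
  linear_combination this

theorem Factored.exists_pull_holCoeff_zero {A : Matrix (Fin 6) (Fin 6) ℝ} (hA : Factored A)
    (h4 : holCoeff A 4 = 0) (h2 : holCoeff A 2 ≠ 0) :
    ∃ f : Matrix (Fin 4) (Fin 4) ℝ, f.det ≠ 0 ∧ Factored (pull f A) ∧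
      holCoeff (pull f A) 4 = 0 ∧ holCoeff (pull f A) 0 = 0 := by
  obtain ⟨-, -, -, h3⟩ := hA.eq_zero_of_holCoeff_four h4
  obtain ⟨t, ht⟩ := exists_quartic_eq_zero_of_quadratic h2 h3 h4
  refine ⟨shift t, by rw [det_shift]; exact one_ne_zero, hA.pull_shift t, ?_, ?_⟩
  · exact quartic_shift_coeff_four h3 h4 fun a => quartic_pull_shift hA.1 t a
  · have := quartic_pull_shift hA.1 t 0
    rw [zero_add, ht] at this
    simpa [quartic] using this

theorem fres_eq_of_minor {A : Matrix (Fin 6) (Fin 6) ℝ} (hA : A.IsSymm) {F : (Fin 4 → ℝ) → ℝ}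
    (hF : Continuous F) (h : ∀ ξ, gramForm A ξ 1 1 * (gramForm A ξ 2 2 * gramForm A ξ 3 3 -
        gramForm A ξ 2 3 * gramForm A ξ 3 2) -
      gramForm A ξ 1 2 * (gramForm A ξ 2 1 * gramForm A ξ 3 3 -
        gramForm A ξ 2 3 * gramForm A ξ 3 1) +
      gramForm A ξ 1 3 * (gramForm A ξ 2 1 * gramForm A ξ 3 2 -
        gramForm A ξ 2 2 * gramForm A ξ 3 1) = ξ 0 ^ 2 * F ξ) (ξ : Fin 4 → ℝ) :
    fres A ξ = F ξ := by
  refine congrFun (eq_of_eq_of_ne (continuous_fres A) hF fun ξ hξ => ?_) ξ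
  have := h ξ
  rw [gramForm_minor hA] at this
  exact mul_left_cancel₀ (pow_ne_zero 2 hξ) this

/-- The bilinear form that pairs `e₀ ∧ e₁` with `e₂ ∧ e₃` and for which `e₀`, `e₁` are null. -/
def nullPair (a b c α σ : ℝ) : Matrix (Fin 6) (Fin 6) ℝ :=
  !![a, 0, 0, b, 0, 0; 0, 0, 0, 0, α, -σ; 0, 0, 0, 0, σ, α; b, 0, 0, c, 0, 0; 0, α, σ, 0, 0, 0;
    0, -σ, α, 0, 0, 0]

/-- The bilinear form of a medium with a repeated null direction `e₁`. -/
def nullRepeated (p q r α σ : ℝ) : Matrix (Fin 6) (Fin 6) ℝ :=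
  !![-σ / 2, 0, 0, α, 0, 0; 0, p, q, 0, α, -σ; 0, q, r, 0, σ, α; α, 0, 0, 2 * σ, 0, 0;
    0, α, σ, 0, 0, 0; 0, -σ, α, 0, 0, 0]

theorem fres_nullPair {a b c α σ : ℝ} (h : (nullPair a b c α σ).IsSymm)
    (hc : (2 * a + σ) * (c - 2 * σ) = 2 * (b - α) ^ 2) (ξ : Fin 4 → ℝ) :
    fres (nullPair a b c α σ) ξ =
      nullForm ξ * (σ ^ 2 * (4 * a * (ξ 0 * ξ 1) + c * (ξ 2 * ξ 2 + ξ 3 * ξ 3))) := by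
  refine fres_eq_of_minor h (F := fun ξ =>
    nullForm ξ * (σ ^ 2 * (4 * a * (ξ 0 * ξ 1) + c * (ξ 2 * ξ 2 + ξ 3 * ξ 3))))
    (by unfold nullForm; fun_prop) (fun ξ => ?_) ξ
  simp [gramForm, ctr, nullPair, nullForm]
  linear_combination (-σ * ξ 0 ^ 2 * (ξ 0 * ξ 1) * (ξ 2 ^ 2 + ξ 3 ^ 2)) * hc

theorem fres_nullRepeated {p q r α σ : ℝ} (h : (nullRepeated p q r α σ).IsSymm)
    (hq : p * r = q ^ 2) (ξ : Fin 4 → ℝ) :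
    fres (nullRepeated p q r α σ) ξ =
      nullForm ξ * (σ ^ 2 * ((p + r) * (ξ 0 * ξ 0) + (-2 * σ) * nullForm ξ)) := by
  refine fres_eq_of_minor h (F := fun ξ =>
    nullForm ξ * (σ ^ 2 * ((p + r) * (ξ 0 * ξ 0) + (-2 * σ) * nullForm ξ)))
    (by unfold nullForm; fun_prop) (fun ξ => ?_) ξ
  simp [gramForm, ctr, nullRepeated, nullForm]
  linear_combination (-σ / 2 * ξ 0 ^ 6) * hq

theorem Factored.coeff_zero_of_holCoeff_four {A : Matrix (Fin 6) (Fin 6) ℝ} (hA : Factored A)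
    (h : holCoeff A 4 = 0) : A 4 4 = 0 ∧ A 5 5 = 0 ∧ A 4 5 = 0 ∧ A 0 4 = 0 ∧ A 0 5 = 0 ∧
      A 3 4 = 0 ∧ A 3 5 = 0 ∧ A 1 4 = A 2 5 ∧ A 1 5 = -A 2 4 := by
  obtain ⟨h0, h1, h2, h3⟩ := hA.eq_zero_of_holCoeff_four h
  rw [Complex.ext_iff] at h h0 h1 h2 h3
  simp [holCoeff, mixCoeff] at h h0 h1 h2 h3
  obtain ⟨h, h'⟩ := h
  obtain ⟨h0, h0'⟩ := h0
  obtain ⟨h1, h1'⟩ := h1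
  obtain ⟨h3, h3'⟩ := h3
  refine ⟨?_, ?_, ?_, ?_, ?_, ?_, ?_, ?_, ?_⟩ <;> linarith

theorem Factored.eq_nullPair {A : Matrix (Fin 6) (Fin 6) ℝ} (hA : Factored A)
    (h : holCoeff A 4 = 0) (h' : holCoeff A 0 = 0) : ∃ a b c α σ : ℝ,
      A = nullPair a b c α σ ∧ (2 * a + σ) * (c - 2 * σ) = 2 * (b - α) ^ 2 := by
  obtain ⟨e44, e55, e45, e04, e05, e34, e35, e14, e15⟩ := hA.coeff_zero_of_holCoeff_four h
  obtain ⟨h20, h21, h22, h3⟩ := hA.eq_zero_of_holCoeff_four h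
  obtain ⟨h0, h1, h2, h3'⟩ := hA.eq_zero_of_holCoeff_zero h'
  have hP := (hA.coeff_mul_quartic 1).2.2.1
  obtain ⟨s1, s2, s3, s4, s5, s6, s7, s8, s9, s10, s11, s12, s13, s14, s15⟩ := isSymm_swap hA.1
  have e00 : A 1 1 = 0 ∧ A 2 2 = 0 ∧ A 1 2 = 0 ∧ A 0 1 = 0 ∧ A 2 3 = 0 ∧ A 0 2 = 0 ∧ A 1 3 = 0 := by
    rw [Complex.ext_iff] at h' h0 h1 h3'
    simp [holCoeff, mixCoeff] at h' h0 h1 h3'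
    obtain ⟨h', h''⟩ := h'
    obtain ⟨h1, h1'⟩ := h1
    obtain ⟨h3', h3''⟩ := h3'
    refine ⟨?_, ?_, ?_, ?_, ?_, ?_, ?_⟩ <;> linarith
  obtain ⟨e11, e22, e12, e01, e23, e02, e13⟩ := e00
  have hW : mixCoeff A 1 0 = 0 ∧ mixCoeff A 1 2 = 0 := by
    simp [mixCoeff, Complex.ext_iff, e01, e23, e02, e13, e05, e34, e04, e35]
  have key : mixCoeff A 1 1 ^ 2 = holCoeff A 2 * starRingEnd ℂ (holCoeff A 2) := by
    simp [quartic, h0, h1, h2, h20, h21, h22, h, h', h3, h3', hW.1, hW.2] at hP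
    exact hP
  refine ⟨A 0 0, A 0 3, A 3 3, A 2 5, A 2 4, ?_, ?_⟩
  · ext i j
    fin_cases i <;> fin_cases j <;> simp [nullPair, *]
  · have := congrArg Complex.re key
    simp [mixCoeff, holCoeff, pow_two, e14, e15] at this
    linear_combination this / 8

theorem Factored.eq_nullRepeated {A : Matrix (Fin 6) (Fin 6) ℝ} (hA : Factored A)
    (h : holCoeff A 4 = 0) (h' : holCoeff A 2 = 0) : ∃ p q r α σ : ℝ,
      A = nullRepeated p q r α σ ∧ p * r = q ^ 2 := by
  obtain ⟨e44, e55, e45, e04, e05, e34, e35, e14, e15⟩ := hA.coeff_zero_of_holCoeff_four h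
  obtain ⟨h20, h21, h22, h3⟩ := hA.eq_zero_of_holCoeff_four h
  obtain ⟨s1, s2, s3, s4, s5, s6, s7, s8, s9, s10, s11, s12, s13, s14, s15⟩ := isSymm_swap hA.1
  have hP (b : ℂ) : mixCoeff A 1 0 + mixCoeff A 1 1 * b + mixCoeff A 1 2 * b ^ 2 = 0 := by
    have := (hA.coeff_mul_quartic b).2.2.1
    simp only [h20, h21, h22, h'] at this
    exact pow_eq_zero_iff two_ne_zero |>.1 (by linear_combination this)
  obtain ⟨h10, h11, h12⟩ := eq_zero_of_forall_quadratic hP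
  have h1 : holCoeff A 1 = 0 := eq_zero_of_mul_conj_quartic fun b => by
    rw [← (hA.coeff_mul_quartic b).2.1]
    simp only [hP]
    ring
  have e : A 0 1 = 0 ∧ A 2 3 = 0 ∧ A 0 2 = 0 ∧ A 1 3 = 0 ∧ A 0 0 = -A 2 4 / 2 ∧
      A 3 3 = 2 * A 2 4 ∧ A 0 3 = A 2 5 := by
    rw [Complex.ext_iff] at h' h10 h11 h1
    simp [holCoeff, mixCoeff] at h' h10 h11 h1
    obtain ⟨h', h''⟩ := h'
    obtain ⟨h10, h10'⟩ := h10
    obtain ⟨h1, h1'⟩ := h1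
    refine ⟨?_, ?_, ?_, ?_, ?_, ?_, ?_⟩ <;> linarith
  obtain ⟨e01, e23, e02, e13, e00, e33, e03⟩ := e
  have key : (mixCoeff A 0 0) ^ 2 = holCoeff A 0 * starRingEnd ℂ (holCoeff A 0) := by
    have := (hA.coeff_mul_quartic 0).1
    simpa [quartic] using this
  refine ⟨A 1 1, A 1 2, A 2 2, A 2 5, A 2 4, ?_, ?_⟩
  · ext i j
    fin_cases i <;> fin_cases j <;> simp [nullRepeated, *]
  · have := congrArg Complex.re key
    simp [mixCoeff, holCoeff, pow_two] at this
    linear_combination this / 4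

/-- The block form with blocks `e₀₁, e₂₃` and `e₀₂, e₀₃, e₃₁, e₁₂`. -/
def blockForm (a b c α β : ℝ) : Matrix (Fin 6) (Fin 6) ℝ :=
  !![a, 0, 0, b, 0, 0; 0, β, 0, 0, α, 0; 0, 0, β, 0, 0, α; b, 0, 0, c, 0, 0; 0, α, 0, 0, -β, 0;
    0, 0, α, 0, 0, -β]

/-- The frame turning the null directions `e₀`, `e₁` into a timelike and a spacelike one. -/
def boostFrame (l : ℝ) : Matrix (Fin 4) (Fin 4) ℝ :=
  !![l / 2, l / 2, 0, 0; l / 2, -l / 2, 0, 0; 0, 0, 1, 0; 0, 0, 0, 1]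

theorem det_boostFrame (l : ℝ) : (boostFrame l).det = -(l ^ 2 / 2) := by
  simp [boostFrame, det_succ_row_zero, Fin.sum_univ_succ, Fin.succAbove]
  ring

theorem compound_boostFrame (l : ℝ) : compound (boostFrame l) =
    !![-(l ^ 2 / 2), 0, 0, 0, 0, 0; 0, l / 2, 0, 0, 0, l / 2; 0, 0, l / 2, 0, -(l / 2), 0;
      0, 0, 0, 1, 0, 0; 0, 0, -(l / 2), 0, -(l / 2), 0; 0, l / 2, 0, 0, 0, -(l / 2)] := by
  ext i j
  fin_cases i <;> fin_cases j <;> simp [compound, pairs, boostFrame] <;> ring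

theorem pull_boostFrame {l : ℝ} (hl : l ≠ 0) (a b c α σ : ℝ) :
    pull (boostFrame l) (nullPair a b c α σ) =
      blockForm (l ^ 2 * a / 2) (-b) (2 * c / l ^ 2) (-α) (-σ) := by
  have hd : |(boostFrame l).det| = l ^ 2 / 2 := by
    rw [det_boostFrame, abs_neg, abs_of_nonneg (by positivity)]
  rw [pull, hd, compound_boostFrame]
  ext i j
  fin_cases i <;> fin_cases j <;>
    simp [nullPair, blockForm, mul_apply, Fin.sum_univ_six] <;> field_simp <;> ring

theorem pull_swapNull_blockForm (a b c α β : ℝ) :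
    pull swapNull (blockForm a b c α β) = blockForm a (-b) c (-α) (-β) := by
  rw [pull, det_swapNull, compound_swapNull]
  ext i j
  fin_cases i <;> fin_cases j <;> simp [blockForm, mul_apply, Fin.sum_univ_six]

/-- The frame permuting `e₁`, `e₂`, `e₃` cyclically. -/
def cycleFrame : Matrix (Fin 4) (Fin 4) ℝ := !![1, 0, 0, 0; 0, 0, 0, 1; 0, 1, 0, 0; 0, 0, 1, 0]

theorem det_cycleFrame : cycleFrame.det = 1 := by
  simp [cycleFrame, det_succ_row_zero, Fin.sum_univ_succ, Fin.succAbove]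

theorem compound_cycleFrame : compound cycleFrame =
    !![0, 0, 1, 0, 0, 0; 1, 0, 0, 0, 0, 0; 0, 1, 0, 0, 0, 0; 0, 0, 0, 0, 0, 1;
      0, 0, 0, 1, 0, 0; 0, 0, 0, 0, 1, 0] := by
  ext i j
  fin_cases i <;> fin_cases j <;> simp [compound, pairs, cycleFrame]

theorem pull_cycleFrame_blockForm (a b c α β : ℝ) : pull cycleFrame (blockForm a b c α β) =
    !![β, 0, 0, α, 0, 0; 0, β, 0, 0, α, 0; 0, 0, a, 0, 0, b; α, 0, 0, -β, 0, 0;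
      0, α, 0, 0, -β, 0; 0, 0, b, 0, 0, c] := by
  rw [pull, det_cycleFrame, compound_cycleFrame]
  ext i j
  fin_cases i <;> fin_cases j <;> simp [blockForm, mul_apply, Fin.sum_univ_six]

theorem metaI_blockForm {a b α β : ℝ} (h : 0 < a * β) (hne : b ≠ α ∨ a ≠ β) :
    MetaI ((blockForm a b (-a) α β).submatrix dual id) := by
  refine ⟨b, α, a, β, left_ne_zero_of_mul h.ne', right_ne_zero_of_mul h.ne', h, hne, ?_⟩
  ext i j
  fin_cases i <;> fin_cases j <;> simp [dual, blockForm]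

theorem classified_blockForm_neg {a b α β : ℝ} (ha : a ≠ 0) (hβ : β ≠ 0)
    (hne : b ≠ α ∨ a ^ 2 ≠ β ^ 2) : Classified (blockForm a b (-a) α β) := by
  rcases lt_or_gt_of_ne (mul_ne_zero ha hβ) with h | h
  · refine ⟨swapNull, by rw [det_swapNull]; norm_num, Or.inl ?_⟩
    rw [pull_swapNull_blockForm]
    refine metaI_blockForm (by linarith) (hne.imp (fun h h' => h (neg_injective h'))
      fun h h' => h ?_)
    rw [h', neg_sq]
  · refine ⟨1, by simp, Or.inl ?_⟩
    rw [pull, compound_one, det_one, abs_one, inv_one, one_smul, transpose_one, Matrix.one_mul,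
      Matrix.mul_one]
    exact metaI_blockForm h (hne.imp_right fun h h' => h (by rw [h']))

theorem classified_blockForm_self {a b α β : ℝ} (ha : a ≠ 0) (hβ : β ≠ 0)
    (hne : b ^ 2 ≠ a ^ 2) : Classified (blockForm a b a α β) := by
  refine ⟨cycleFrame, by rw [det_cycleFrame]; exact one_ne_zero,
    Or.inr (Or.inr ⟨α, b, a, β, hβ, ha, hne, ?_⟩)⟩
  rw [pull_cycleFrame_blockForm]
  ext i j
  fin_cases i <;> fin_cases j <;> simp [dual]

theorem classified_nullPair {a b c α σ : ℝ} (ha : a ≠ 0) (hc : c ≠ 0) (hσ : σ ≠ 0)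
    (hd : a * c ≠ b ^ 2) (h4 : 4 * a + c ≠ 0)
    (h : (2 * a + σ) * (c - 2 * σ) = 2 * (b - α) ^ 2) : Classified (nullPair a b c α σ) := by
  obtain ⟨l, hl, hl4⟩ : ∃ l : ℝ, l ≠ 0 ∧ (l ^ 2) ^ 2 = 4 * |c / a| := by
    have : 0 < |c / a| := by positivity
    refine ⟨√(2 * √|c / a|), by positivity, ?_⟩
    rw [Real.sq_sqrt (by positivity), mul_pow, Real.sq_sqrt (by positivity)]
    norm_num
  refine Classified.of_pull (f := boostFrame l) (by rw [det_boostFrame]; simpa using hl) ?_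
  rw [pull_boostFrame hl]
  have hsq : (l ^ 2 * a / 2) ^ 2 = a ^ 2 * |c / a| := by linear_combination (a ^ 2 / 4) * hl4
  have hla : l ^ 2 * a / 2 ≠ 0 := by positivity
  rcases lt_or_gt_of_ne (div_ne_zero hc ha) with hca | hca
  · rw [abs_of_neg hca] at hl4 hsq
    have e : 2 * c / l ^ 2 = -(l ^ 2 * a / 2) := by
      field_simp at hl4 ⊢
      linear_combination hl4
    have hsq' : (l ^ 2 * a / 2) ^ 2 = -(a * c) := by rw [hsq]; field_simp
    rw [e]
    refine classified_blockForm_neg hla (neg_ne_zero.2 hσ) ?_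
    by_contra! hcon
    obtain ⟨h1, h2⟩ := hcon
    rw [hsq', neg_sq] at h2
    have hb : b = α := neg_injective h1
    subst hb
    have h5 : σ * (c - 4 * a - 4 * σ) = 0 := by linear_combination h + 2 * h2
    have h6 : c = 4 * a + 4 * σ := by linarith [(mul_eq_zero.1 h5).resolve_left hσ]
    subst h6
    have h7 : (2 * a + σ) ^ 2 = 0 := by linear_combination -h2
    exact h4 (by linarith [pow_eq_zero_iff two_ne_zero |>.1 h7])
  · rw [abs_of_pos hca] at hl4 hsq
    have e : 2 * c / l ^ 2 = l ^ 2 * a / 2 := by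
      field_simp at hl4 ⊢
      linear_combination -hl4
    rw [e]
    refine classified_blockForm_self hla (neg_ne_zero.2 hσ) fun h' => hd ?_
    rw [hsq, neg_sq] at h'
    rw [h']
    field_simp

/-- The frame bringing `nullRepeated` to normal form. -/
def repeatedFrame (k m s N : ℝ) : Matrix (Fin 4) (Fin 4) ℝ :=
  !![1, 0, 0, 0; k, 0, 0, 2 * N; 0, m, -s, 0; 0, s, m, 0]

theorem det_repeatedFrame {k m s N : ℝ} (h : m ^ 2 + s ^ 2 = N) :
    (repeatedFrame k m s N).det = 2 * N ^ 2 := by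
  simp [repeatedFrame, det_succ_row_zero, Fin.sum_univ_succ, Fin.succAbove]
  linear_combination (2 * N) * h

theorem compound_repeatedFrame (k m s N : ℝ) : compound (repeatedFrame k m s N) =
    !![0, 0, 2 * N, 0, 0, 0; m, -s, 0, 0, 0, 0; s, m, 0, 0, 0, 0; 0, 0, 0, 0, 0, m ^ 2 + s ^ 2;
      -(k * s), -(k * m), 0, 2 * N * m, -(2 * N * s), 0;
      k * m, -(k * s), 0, 2 * N * s, 2 * N * m, 0] := by
  ext i j
  fin_cases i <;> fin_cases j <;> simp [compound, pairs, repeatedFrame] <;> ring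

theorem pull_repeatedFrame {k m s N p q r α σ : ℝ} (hN : m ^ 2 + s ^ 2 = N) (hN0 : N ≠ 0)
    (hk : p + r = 4 * k * σ) (h1 : 2 * (m ^ 2 - s ^ 2) = q) (h2 : 8 * (m * s) = r - p) :
    pull (repeatedFrame k m s N) (nullRepeated p q r α σ) =
      !![0, 1, 0, α, -σ, 0; 1, 0, 0, σ, α, 0; 0, 0, -σ, 0, 0, α; α, σ, 0, 0, 0, 0;
        -σ, α, 0, 0, 0, 0; 0, 0, α, 0, 0, σ] := by
  have hp : p = 2 * k * σ - 4 * (m * s) := by linarith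
  have hr : r = 2 * k * σ + 4 * (m * s) := by linarith
  subst h1 hp hr
  rw [pull, det_repeatedFrame hN, abs_of_pos (by positivity), compound_repeatedFrame, hN]
  ext i j
  fin_cases i <;> fin_cases j <;>
    simp [nullRepeated, mul_apply, Fin.sum_univ_six] <;> field_simp <;> subst hN <;>
    first | ring1 | exact Or.inr (by ring)

theorem classified_nullRepeated {p q r α σ : ℝ} (hσ : σ ≠ 0) (hq : p * r = q ^ 2)
    (hpr : p + r ≠ 0) : Classified (nullRepeated p q r α σ) := by
  obtain ⟨z, hz⟩ := IsAlgClosed.exists_pow_nat_eq (⟨q / 2, (r - p) / 4⟩ : ℂ) two_pos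
  have h1 : 2 * (z.re ^ 2 - z.im ^ 2) = q := by
    have := congrArg Complex.re hz
    simp [pow_two] at this
    linear_combination 2 * this
  have h2 : 8 * (z.re * z.im) = r - p := by
    have := congrArg Complex.im hz
    simp [pow_two] at this
    linear_combination 4 * this
  have hN : z.re ^ 2 + z.im ^ 2 ≠ 0 := fun h => by
    have : (z.re ^ 2 + z.im ^ 2) ^ 2 = (p + r) ^ 2 / 16 := by
      linear_combination ((2 * (z.re ^ 2 - z.im ^ 2) + q) / 4) * h1 +
        (8 * (z.re * z.im) + (r - p)) / 16 * h2 - hq / 4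
    rw [h] at this
    exact hpr (pow_eq_zero_iff two_ne_zero |>.1 (by linarith))
  refine ⟨repeatedFrame ((p + r) / (4 * σ)) z.re z.im (z.re ^ 2 + z.im ^ 2),
    by rw [det_repeatedFrame rfl]; positivity, Or.inr (Or.inl ⟨α, -σ, neg_ne_zero.2 hσ, ?_⟩)⟩
  rw [pull_repeatedFrame rfl hN (by field_simp) h1 h2]
  ext i j
  fin_cases i <;> fin_cases j <;> simp [dual]

theorem Factored.classified {A : Matrix (Fin 6) (Fin 6) ℝ} (hA : Factored A) : Classified A := by
  obtain ⟨f, hf, hA', h4⟩ := hA.exists_pull_holCoeff_four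
  refine Classified.of_pull hf ?_
  generalize pull f A = B at hA' h4
  have hρ : IsQuad fun ξ => ξ 2 * ξ 2 + ξ 3 * ξ 3 :=
    ((isLin_apply 2).mul (isLin_apply 2)).add ((isLin_apply 3).mul (isLin_apply 3))
  by_cases h2 : holCoeff B 2 = 0
  · obtain ⟨p, q, r, α, σ, rfl, hq⟩ := hA'.eq_nullRepeated h4 h2
    obtain ⟨hs, -, Q, hQ, hQn, hG, hQc⟩ := hA'
    have hQ' := hQ.eq_of_nullForm_mul (((((isLin_apply 0).mul (isLin_apply 0)).const_mul
      (p + r)).add (isQuad_nullForm.const_mul (-2 * σ))).const_mul (σ ^ 2)) fun ξ => by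
        rw [← hG, fres_nullRepeated hs hq]
    refine classified_nullRepeated (fun hσ => ?_) hq fun hpr => ?_
    · exact hQc ⟨0, fun ξ => by rw [hQ', hσ]; ring⟩
    · exact hQc ⟨-2 * σ ^ 3, fun ξ => by rw [hQ', hpr]; ring⟩
  · obtain ⟨g, hg, hB, h4', h0⟩ := hA'.exists_pull_holCoeff_zero h4 h2
    refine Classified.of_pull hg ?_
    obtain ⟨a, b, c, α, σ, hB', hc⟩ := hB.eq_nullPair h4' h0
    rw [hB'] at hB ⊢
    obtain ⟨hs, hd, Q, hQ, hQn, hG, hQc⟩ := hB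
    have hQ' := hQ.eq_of_nullForm_mul (((((isLin_apply 0).mul (isLin_apply 1)).const_mul
      (4 * a)).add (hρ.const_mul c)).const_mul (σ ^ 2)) fun ξ => by
        rw [← hG, fres_nullPair hs hc]
    have hc0 : c ≠ 0 := fun h => by
      have := congrFun (hQn ![0, 0, 1, 0] fun ξ => by
        rw [hQ', hQ', h]; simp) 2
      simp at this
    refine classified_nullPair (fun h => ?_) hc0 (fun h => ?_) (fun h => hd ?_) (fun h => ?_) hc
    · have := congrFun (hQn ![1, 0, 0, 0] fun ξ => by
        rw [hQ', hQ', h]; simp) 0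
      simp at this
    · exact hQc ⟨0, fun ξ => by rw [hQ', h]; ring⟩
    · refine exists_mulVec_eq_zero_iff.1 ⟨![c, 0, 0, -b, 0, 0], fun h => ?_, ?_⟩
      · exact hc0 (congrFun h 0)
      · funext i
        fin_cases i <;> simp [nullPair, mulVec, dotProduct, Fin.sum_univ_six]
        · linear_combination h
        · ring
    · refine hQc ⟨4 * a * σ ^ 2, fun ξ => ?_⟩
      rw [hQ', nullForm]
      linear_combination (σ ^ 2 * (ξ 2 * ξ 2 + ξ 3 * ξ 3)) * h

/-- `z` is a complex eigenvalue of the real matrix `M`. -/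
def IsEig (M : Matrix (Fin 6) (Fin 6) ℝ) (z : ℂ) : Prop :=
  ∃ v : Fin 6 → ℂ, v ≠ 0 ∧ M.map Complex.ofReal *ᵥ v = z • v

theorem IsEig.smul_conj {M T S : Matrix (Fin 6) (Fin 6) ℝ} {z : ℂ} (h : IsEig M z)
    (hST : S * T = 1) (s : ℝ) : IsEig (s • (T * M * S)) (s * z) := by
  obtain ⟨v, hv, hz⟩ := h
  have hST' : S.map Complex.ofReal * T.map Complex.ofReal = 1 := by
    have := congrArg (fun A => A.map Complex.ofRealHom) hST
    rw [Matrix.map_mul, Matrix.map_one _ (map_zero _) (map_one _)] at this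
    exact this
  have hmap : (s • (T * M * S)).map Complex.ofReal =
      (s : ℂ) • (T.map Complex.ofReal * M.map Complex.ofReal * S.map Complex.ofReal) := by
    ext i j
    simp [mul_apply]
  refine ⟨T.map Complex.ofReal *ᵥ v, fun h => hv ?_, ?_⟩
  · rw [← one_mulVec v, ← hST', ← mulVec_mulVec, h, mulVec_zero]
  · rw [hmap, smul_mulVec, ← mulVec_mulVec, mulVec_mulVec _ (S.map _), hST', one_mulVec,
      ← mulVec_mulVec, hz, mulVec_smul, smul_smul]

theorem InClass.exists_isEig {M : Matrix (Fin 6) (Fin 6) ℝ}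
    {C : Matrix (Fin 6) (Fin 6) ℝ → Prop} (h : InClass M C) :
    ∃ R, C R ∧ ∃ s : ℝ, s * s = 1 ∧ (∀ z, IsEig M z → IsEig R (s * z)) ∧
      ∀ z, IsEig R z → IsEig M (s * z) := by
  obtain ⟨P, hP, hC⟩ := h
  have hu := isUnit_det_compound hP.ne_zero
  have hs : Real.sign P.det * Real.sign P.det = 1 := by
    rcases Real.sign_apply_eq_of_ne_zero P.det hP.ne_zero with h | h <;> rw [h] <;> norm_num
  refine ⟨_, hC, Real.sign P.det, hs, fun z hz => hz.smul_conj (nonsing_inv_mul _ hu) _,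
    fun z hz => ?_⟩
  have := hz.smul_conj (mul_nonsing_inv _ hu) (Real.sign P.det)
  convert this using 1
  rw [Matrix.mul_smul, Matrix.smul_mul, smul_smul, hs, one_smul, Matrix.mul_assoc,
    Matrix.mul_assoc, Matrix.mul_assoc, nonsing_inv_mul _ hu, Matrix.mul_one, ← Matrix.mul_assoc,
    nonsing_inv_mul _ hu, Matrix.one_mul]

theorem eq_zero_of_rotation {α β x y z : ℂ} (hz : (z - α) ^ 2 + β ^ 2 ≠ 0)
    (h1 : α * x - β * y = z * x) (h2 : β * x + α * y = z * y) : x = 0 ∧ y = 0 := by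
  constructor
  · refine (mul_eq_zero.1 (?_ : ((z - α) ^ 2 + β ^ 2) * x = 0)).resolve_left hz
    linear_combination (-(z - α)) * h1 + β * h2
  · refine (mul_eq_zero.1 (?_ : ((z - α) ^ 2 + β ^ 2) * y = 0)).resolve_left hz
    linear_combination (-(z - α)) * h2 - β * h1

theorem MetaIV.exists_isEig {R : Matrix (Fin 6) (Fin 6) ℝ} (h : MetaIV R) :
    ∃ x : ℝ, IsEig R x := by
  obtain ⟨α₁, α₃, α₄, β₁, -, -, -, rfl⟩ := h
  refine ⟨α₃ + α₄, ![0, 0, 1, 0, 0, 1], fun h => by simpa using congrFun h 2, ?_⟩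
  funext i
  fin_cases i <;> simp [mulVec, dotProduct, Fin.sum_univ_six]
  ring

theorem isEig_metaI {α₁ α₂ β₁ β₂ : ℝ} {z : ℂ}
    (h : IsEig !![α₁, 0, 0, -β₁, 0, 0; 0, α₂, 0, 0, -β₂, 0; 0, 0, α₂, 0, 0, -β₂;
      β₁, 0, 0, α₁, 0, 0; 0, β₂, 0, 0, α₂, 0; 0, 0, β₂, 0, 0, α₂] z) :
    (z - α₁) ^ 2 + (β₁ : ℂ) ^ 2 = 0 ∨ (z - α₂) ^ 2 + (β₂ : ℂ) ^ 2 = 0 := by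
  obtain ⟨v, hv, h⟩ := h
  by_contra! hne
  have e (i) := congrFun h i
  simp [mulVec, dotProduct, Fin.sum_univ_six, Fin.forall_fin_succ] at e
  obtain ⟨e0, e1, e2, e3, e4, e5⟩ := e
  obtain ⟨h0, h3⟩ := eq_zero_of_rotation hne.1 (by linear_combination e0) e3
  obtain ⟨h1, h4⟩ := eq_zero_of_rotation hne.2 (by linear_combination e1) e4
  obtain ⟨h2, h5⟩ := eq_zero_of_rotation hne.2 (by linear_combination e2) e5
  exact hv (by funext i; fin_cases i <;> assumption)

theorem isEig_metaII {α β : ℝ} {z : ℂ}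
    (h : IsEig !![α, -β, 0, 0, 0, 0; β, α, 0, 0, 0, 0; 0, 0, α, 0, 0, -β; 0, 1, 0, α, β, 0;
      1, 0, 0, -β, α, 0; 0, 0, β, 0, 0, α] z) : (z - α) ^ 2 + (β : ℂ) ^ 2 = 0 := by
  obtain ⟨v, hv, h⟩ := h
  by_contra! hne
  have e (i) := congrFun h i
  simp [mulVec, dotProduct, Fin.sum_univ_six, Fin.forall_fin_succ] at e
  obtain ⟨e0, e1, e2, e3, e4, e5⟩ := e
  obtain ⟨h0, h1⟩ := eq_zero_of_rotation hne (by linear_combination e0) e1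
  obtain ⟨h2, h5⟩ := eq_zero_of_rotation hne (by linear_combination e2) e5
  obtain ⟨h4, h3⟩ := eq_zero_of_rotation hne (x := v 4) (y := v 3)
    (by linear_combination e4 - h0) (by linear_combination e3 - h1)
  exact hv (by funext i; fin_cases i <;> assumption)

theorem sq_add_sq_ne_zero {x α β : ℝ} (hβ : β ≠ 0) : ((x : ℂ) - α) ^ 2 + (β : ℂ) ^ 2 ≠ 0 := by
  norm_cast
  positivity

theorem isEig_metaI_fst (α₁ α₂ β₁ β₂ : ℝ) :
    IsEig !![α₁, 0, 0, -β₁, 0, 0; 0, α₂, 0, 0, -β₂, 0; 0, 0, α₂, 0, 0, -β₂;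
      β₁, 0, 0, α₁, 0, 0; 0, β₂, 0, 0, α₂, 0; 0, 0, β₂, 0, 0, α₂] ⟨α₁, β₁⟩ := by
  refine ⟨![1, 0, 0, -Complex.I, 0, 0], fun h => by simpa using congrFun h 0, ?_⟩
  rw [Complex.mk_eq_add_mul_I]
  funext i
  fin_cases i <;> simp [mulVec, dotProduct, Fin.sum_univ_six]
  linear_combination (β₁ : ℂ) * Complex.I_sq

theorem isEig_metaI_snd (α₁ α₂ β₁ β₂ : ℝ) :
    IsEig !![α₁, 0, 0, -β₁, 0, 0; 0, α₂, 0, 0, -β₂, 0; 0, 0, α₂, 0, 0, -β₂;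
      β₁, 0, 0, α₁, 0, 0; 0, β₂, 0, 0, α₂, 0; 0, 0, β₂, 0, 0, α₂] ⟨α₂, β₂⟩ := by
  refine ⟨![0, 1, 0, 0, -Complex.I, 0], fun h => by simpa using congrFun h 1, ?_⟩
  rw [Complex.mk_eq_add_mul_I]
  funext i
  fin_cases i <;> simp [mulVec, dotProduct, Fin.sum_univ_six]
  linear_combination (β₂ : ℂ) * Complex.I_sq

theorem eq_of_sign_mul_sq {s α β a b : ℝ} (hs : s * s = 1) (hb : b ≠ 0)
    (h : ((s : ℂ) * ⟨a, b⟩ - α) ^ 2 + (β : ℂ) ^ 2 = 0) : s * a = α ∧ b ^ 2 = β ^ 2 := by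
  have h1 := congrArg Complex.re h
  have h2 := congrArg Complex.im h
  simp [pow_two] at h1 h2
  have hs0 : s ≠ 0 := left_ne_zero_of_mul_eq_one hs
  have h3 : s * a - α = 0 := by
    have : (s * a - α) * (s * b) = 0 := by linear_combination h2 / 2
    exact (mul_eq_zero.1 this).resolve_right (mul_ne_zero hs0 hb)
  refine ⟨sub_eq_zero.1 h3, ?_⟩
  linear_combination (s * a - α) * h3 - h1 - b ^ 2 * hs

theorem not_metaI_and_metaIV {M : Matrix (Fin 6) (Fin 6) ℝ} :
    ¬(InClass M MetaI ∧ InClass M MetaIV) := by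
  rintro ⟨h1, h2⟩
  obtain ⟨R, ⟨α₁, α₂, β₁, β₂, hβ₁, hβ₂, -, -, rfl⟩, s, -, hs, -⟩ := h1.exists_isEig
  obtain ⟨S, hS, t, -, -, ht⟩ := h2.exists_isEig
  obtain ⟨x, hx⟩ := hS.exists_isEig
  have := isEig_metaI (hs _ (ht _ hx))
  rw [← Complex.ofReal_mul, ← Complex.ofReal_mul] at this
  exact this.elim (sq_add_sq_ne_zero hβ₁) (sq_add_sq_ne_zero hβ₂)

theorem not_metaII_and_metaIV {M : Matrix (Fin 6) (Fin 6) ℝ} :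
    ¬(InClass M MetaII ∧ InClass M MetaIV) := by
  rintro ⟨h1, h2⟩
  obtain ⟨R, ⟨α, β, hβ, rfl⟩, s, -, hs, -⟩ := h1.exists_isEig
  obtain ⟨S, hS, t, -, -, ht⟩ := h2.exists_isEig
  obtain ⟨x, hx⟩ := hS.exists_isEig
  have := isEig_metaII (hs _ (ht _ hx))
  rw [← Complex.ofReal_mul, ← Complex.ofReal_mul] at this
  exact sq_add_sq_ne_zero hβ this

theorem not_metaI_and_metaII {M : Matrix (Fin 6) (Fin 6) ℝ} :
    ¬(InClass M MetaI ∧ InClass M MetaII) := by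
  rintro ⟨h1, h2⟩
  obtain ⟨R, ⟨α₁, α₂, β₁, β₂, hβ₁, hβ₂, hβ, hne, rfl⟩, s, hs, -, hR⟩ := h1.exists_isEig
  obtain ⟨S, ⟨α, β, -, rfl⟩, t, ht, hS, -⟩ := h2.exists_isEig
  have hst : t * s * (t * s) = 1 := by rw [mul_mul_mul_comm, hs, ht, one_mul]
  have e1 := isEig_metaII (hS _ (hR _ (isEig_metaI_fst α₁ α₂ β₁ β₂)))
  have e2 := isEig_metaII (hS _ (hR _ (isEig_metaI_snd α₁ α₂ β₁ β₂)))
  rw [← mul_assoc, ← Complex.ofReal_mul] at e1 e2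
  obtain ⟨h3, h4⟩ := eq_of_sign_mul_sq hst hβ₁ e1
  obtain ⟨h5, h6⟩ := eq_of_sign_mul_sq hst hβ₂ e2
  rcases hne with h | h
  · exact h (mul_left_cancel₀ (left_ne_zero_of_mul_eq_one hst) (h3.trans h5.symm))
  · rcases sq_eq_sq_iff_eq_or_eq_neg.1 (h4.trans h6.symm) with h7 | h7
    · exact h h7
    · rw [h7] at hβ
      nlinarith [sq_nonneg β₂]

theorem doubleCone_of_fresnel_eq {κ : MT} {g h : Matrix (Fin 4) (Fin 4) ℝ} {k : ℝ} (hk : k ≠ 0)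
    (hg : IsLorentz g) (hh : IsLorentz h)
    (hκ : ∀ ξ, fresnel κ ξ = k * (ξ ⬝ᵥ g *ᵥ ξ) * (ξ ⬝ᵥ h *ᵥ ξ)) {ξ : Fin 4 → ℝ}
    (h0 : ξ ⬝ᵥ g *ᵥ ξ = 0) (h1 : ξ ⬝ᵥ h *ᵥ ξ ≠ 0) : DoubleCone κ := by
  have hinv {g : Matrix (Fin 4) (Fin 4) ℝ} (hg : IsLorentz g) : IsLorentz g⁻¹ := by
    refine ⟨by rw [IsSymm, transpose_nonsing_inv, hg.1.eq], ?_⟩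
    rw [det_nonsing_inv, Ring.inverse_eq_inv']
    exact inv_lt_zero.2 hg.2
  have hmem {g : Matrix (Fin 4) (Fin 4) ℝ} (hg : IsLorentz g) (ξ : Fin 4 → ℝ) :
      ξ ∈ nullCone g⁻¹ ↔ ξ ⬝ᵥ g *ᵥ ξ = 0 := by
    rw [mem_nullCone, nonsing_inv_nonsing_inv _ (isUnit_iff_ne_zero.2 hg.2.ne)]
  refine ⟨g⁻¹, h⁻¹, hinv hg, hinv hh, fun e => h1 ?_, ?_⟩
  · rw [← hmem hh, ← e, hmem hg, h0]
  · ext ξ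
    rw [Set.mem_union, hmem hg, hmem hh, Set.mem_ofPred_eq, hκ, mul_eq_zero, mul_eq_zero]
    simp [hk]

/-- The quadratic form `ξ₀² - ξ₁² - r (ξ₂² + ξ₃²)`. -/
def splitMetric (r : ℝ) : Matrix (Fin 4) (Fin 4) ℝ := diagonal ![1, -1, -r, -r]

theorem isLorentz_splitMetric {r : ℝ} (hr : r ≠ 0) : IsLorentz (splitMetric r) := by
  refine ⟨diagonal_transpose _, ?_⟩
  rw [splitMetric, det_diagonal]
  simp [Fin.prod_univ_four]
  exact hr

theorem splitMetric_apply (r : ℝ) (ξ : Fin 4 → ℝ) : ξ ⬝ᵥ splitMetric r *ᵥ ξ =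
    ξ 0 ^ 2 - ξ 1 ^ 2 - r * (ξ 2 ^ 2 + ξ 3 ^ 2) := by
  simp [splitMetric, mulVec_diagonal, dotProduct, Fin.sum_univ_four]
  ring

theorem isSymm_blockForm (a b c α β : ℝ) : (blockForm a b c α β).IsSymm := by
  ext i j
  fin_cases i <;> fin_cases j <;> simp [blockForm]

theorem fres_blockForm (a b c α β : ℝ) (ξ : Fin 4 → ℝ) :
    fres (blockForm a b c α β) ξ = β * (a * β * (ξ 0 ^ 2 - ξ 1 ^ 2) ^ 2 +
      (ξ 0 ^ 2 - ξ 1 ^ 2) * (ξ 2 ^ 2 + ξ 3 ^ 2) * (a * c - (b - α) ^ 2 - β ^ 2) -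
      c * β * (ξ 2 ^ 2 + ξ 3 ^ 2) ^ 2) := by
  refine fres_eq_of_minor (isSymm_blockForm a b c α β) (F := fun ξ =>
    β * (a * β * (ξ 0 ^ 2 - ξ 1 ^ 2) ^ 2 +
      (ξ 0 ^ 2 - ξ 1 ^ 2) * (ξ 2 ^ 2 + ξ 3 ^ 2) * (a * c - (b - α) ^ 2 - β ^ 2) -
      c * β * (ξ 2 ^ 2 + ξ 3 ^ 2) ^ 2)) (by fun_prop) (fun ξ => ?_) ξ
  simp [gramForm, ctr, blockForm]
  ring

/-- Positivity of the discriminant splits the Fresnel polynomial of a block form. -/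
theorem exists_fres_blockForm_eq {a b c α β : ℝ} (ha : a ≠ 0) (hc : c ≠ 0) (hβ : β ≠ 0)
    (h : 0 < (a * c - (b - α) ^ 2 - β ^ 2) ^ 2 + 4 * a * c * β ^ 2) :
    ∃ k r s : ℝ, k ≠ 0 ∧ r ≠ 0 ∧ s ≠ 0 ∧ r ≠ s ∧ ∀ ξ, fres (blockForm a b c α β) ξ =
      k * (ξ ⬝ᵥ splitMetric r *ᵥ ξ) * (ξ ⬝ᵥ splitMetric s *ᵥ ξ) := by
  set e := a * c - (b - α) ^ 2 - β ^ 2 with he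
  set d := Real.sqrt (e ^ 2 + 4 * a * c * β ^ 2) with hd
  have hd0 : d ≠ 0 := (Real.sqrt_pos.2 h).ne'
  have hd2 : d ^ 2 = e ^ 2 + 4 * a * c * β ^ 2 := Real.sq_sqrt h.le
  have hrs : (-e + d) / (2 * a * β) * ((-e - d) / (2 * a * β)) = -c / a := by
    field_simp
    linear_combination -hd2
  have hrs0 : (-e + d) / (2 * a * β) * ((-e - d) / (2 * a * β)) ≠ 0 := by
    rw [hrs]
    exact div_ne_zero (neg_ne_zero.2 hc) ha
  refine ⟨a * β ^ 2, (-e + d) / (2 * a * β), (-e - d) / (2 * a * β),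
    mul_ne_zero ha (pow_ne_zero 2 hβ), left_ne_zero_of_mul hrs0, right_ne_zero_of_mul hrs0,
    fun h => hd0 ?_, fun ξ => ?_⟩
  · field_simp at h
    linarith
  · rw [fres_blockForm, splitMetric_apply, splitMetric_apply, ← he]
    generalize ξ 0 ^ 2 - ξ 1 ^ 2 = Y
    generalize ξ 2 ^ 2 + ξ 3 ^ 2 = ρ
    have hsum : (-e + d) / (2 * a * β) + (-e - d) / (2 * a * β) = -e / (a * β) := by
      field_simp
      ring
    generalize (-e + d) / (2 * a * β) = r at *
    generalize (-e - d) / (2 * a * β) = s at *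
    field_simp at hrs hsum
    linear_combination (-β ^ 2 * ρ ^ 2) * hrs + β * Y * ρ * hsum

theorem doubleCone_pull_blockForm {f : Matrix (Fin 4) (Fin 4) ℝ} (hf : f.det ≠ 0)
    {a b c α β : ℝ} (ha : a ≠ 0) (hc : c ≠ 0) (hβ : β ≠ 0)
    (h : 0 < (a * c - (b - α) ^ 2 - β ^ 2) ^ 2 + 4 * a * c * β ^ 2) :
    DoubleCone (medium (pull f (blockForm a b c α β))) := by
  obtain ⟨k, r, s, hk, hr, hs, hrs, hfres⟩ := exists_fres_blockForm_eq ha hc hβ h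
  have hB := isSymm_blockForm a b c α β
  have hL {r : ℝ} (hr : r ≠ 0) : IsLorentz (fᵀ * splitMetric r * f) := by
    have := isLorentz_splitMetric hr
    refine ⟨by rw [IsSymm, transpose_mul, transpose_mul, this.1.eq, transpose_transpose,
      Matrix.mul_assoc], ?_⟩
    rw [det_mul, det_mul, det_transpose, mul_right_comm]
    exact mul_neg_of_pos_of_neg (mul_self_pos.2 hf) this.2
  have hap (r : ℝ) (ξ : Fin 4 → ℝ) : ξ ⬝ᵥ (fᵀ * splitMetric r * f) *ᵥ ξ =
      (f *ᵥ ξ) ⬝ᵥ splitMetric r *ᵥ (f *ᵥ ξ) := by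
    rw [← mulVec_mulVec, ← mulVec_mulVec, dotProduct_mulVec, vecMul_transpose]
  have hff : f *ᵥ (f⁻¹ *ᵥ ![(r + 1) / 2, (r - 1) / 2, 1, 0]) = ![(r + 1) / 2, (r - 1) / 2, 1, 0] := by
    rw [mulVec_mulVec, mul_nonsing_inv _ (isUnit_iff_ne_zero.2 hf), one_mulVec]
  refine doubleCone_of_fresnel_eq (mul_ne_zero (inv_ne_zero (abs_ne_zero.2 hf)) hk) (hL hr) (hL hs)
    (fun ξ => ?_) (ξ := f⁻¹ *ᵥ ![(r + 1) / 2, (r - 1) / 2, 1, 0]) ?_ ?_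
  · rw [fresnel_medium (pull_isSymm hB f), fres_pull hB hf, hfres, hap, hap]
    ring
  · rw [hap, hff, splitMetric_apply]
    simp
    ring
  · rw [hap, hff, splitMetric_apply]
    simp
    intro h
    exact hrs (by linear_combination h)

theorem MetaI.doubleCone {R : Matrix (Fin 6) (Fin 6) ℝ} (h : MetaI R) :
    DoubleCone (tensorOf R) := by
  obtain ⟨α₁, α₂, β₁, β₂, h1, h2, h3, h4, rfl⟩ := h
  rw [tensorOf_eq_medium]
  have hd : 0 < (β₁ * -β₁ - (α₁ - α₂) ^ 2 - β₂ ^ 2) ^ 2 + 4 * β₁ * -β₁ * β₂ ^ 2 := by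
    have : (β₁ * -β₁ - (α₁ - α₂) ^ 2 - β₂ ^ 2) ^ 2 + 4 * β₁ * -β₁ * β₂ ^ 2 =
      ((β₁ - β₂) ^ 2 + (α₁ - α₂) ^ 2) * ((β₁ + β₂) ^ 2 + (α₁ - α₂) ^ 2) := by ring
    rw [this]
    have hp : 0 < (β₁ - β₂) ^ 2 + (α₁ - α₂) ^ 2 := by
      rcases h4 with h | h
      · have := sub_ne_zero.2 h
        positivity
      · have := sub_ne_zero.2 h
        positivity
    have : 0 < (β₁ + β₂) ^ 2 := by nlinarith [sq_nonneg β₁, sq_nonneg β₂]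
    positivity
  have := doubleCone_pull_blockForm (f := 1) (by simp) h1 (neg_ne_zero.2 h1) h2 hd
  rw [pull, compound_one, det_one, abs_one, inv_one, one_smul, transpose_one, Matrix.one_mul,
    Matrix.mul_one] at this
  convert this using 2
  ext i j
  fin_cases i <;> fin_cases j <;> simp [blockForm, dual]

theorem MetaIV.doubleCone {R : Matrix (Fin 6) (Fin 6) ℝ} (h : MetaIV R) :
    DoubleCone (tensorOf R) := by
  obtain ⟨α₁, α₃, α₄, β₁, h1, h2, -, rfl⟩ := h
  rw [tensorOf_eq_medium]
  have hd : 0 < (α₄ * α₄ - (α₃ - α₁) ^ 2 - β₁ ^ 2) ^ 2 + 4 * α₄ * α₄ * β₁ ^ 2 := by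
    have : 0 < 4 * (α₄ ^ 2 * β₁ ^ 2) := by positivity
    nlinarith [sq_nonneg (α₄ * α₄ - (α₃ - α₁) ^ 2 - β₁ ^ 2)]
  have := doubleCone_pull_blockForm (f := cycleFrame) (by rw [det_cycleFrame]; simp) h2 h2 h1 hd
  rw [pull_cycleFrame_blockForm] at this
  convert this using 2
  ext i j
  fin_cases i <;> fin_cases j <;> simp [dual]

/-- The normal form of Metaclass II as a bilinear form. -/
def shearForm (α β : ℝ) : Matrix (Fin 6) (Fin 6) ℝ :=
  !![0, 1, 0, α, β, 0; 1, 0, 0, -β, α, 0; 0, 0, β, 0, 0, α;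
    α, -β, 0, 0, 0, 0; β, α, 0, 0, 0, 0; 0, 0, α, 0, 0, -β]

/-- The factors of the Fresnel polynomial of `shearForm`. -/
def shearMetric (s β : ℝ) : Matrix (Fin 4) (Fin 4) ℝ :=
  !![s, 0, 0, -β; 0, β, 0, 0; 0, 0, β, 0; -β, 0, 0, 0]

theorem shearMetric_apply (s β : ℝ) (ξ : Fin 4 → ℝ) : ξ ⬝ᵥ shearMetric s β *ᵥ ξ =
    s * ξ 0 ^ 2 + β * (ξ 1 ^ 2 + ξ 2 ^ 2 - 2 * ξ 0 * ξ 3) := by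
  simp [shearMetric, mulVec, dotProduct, Fin.sum_univ_four]
  ring

theorem isLorentz_shearMetric (s : ℝ) {β : ℝ} (hβ : β ≠ 0) : IsLorentz (shearMetric s β) := by
  have : (shearMetric s β).det = -β ^ 4 := by
    simp [shearMetric, det_succ_row_zero, Fin.sum_univ_succ, Fin.succAbove]
    ring
  refine ⟨?_, by rw [this]; exact neg_neg_of_pos (by positivity)⟩
  ext i j
  fin_cases i <;> fin_cases j <;> simp [shearMetric]

theorem fres_shearForm (α β : ℝ) (ξ : Fin 4 → ℝ) : fres (shearForm α β) ξ =
    β * (ξ ⬝ᵥ shearMetric 1 β *ᵥ ξ) * (ξ ⬝ᵥ shearMetric (-1) β *ᵥ ξ) := by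
  have hs : (shearForm α β).IsSymm := by
    ext i j
    fin_cases i <;> fin_cases j <;> simp [shearForm]
  simp only [shearMetric_apply]
  refine fres_eq_of_minor hs (F := fun ξ => β *
    (1 * ξ 0 ^ 2 + β * (ξ 1 ^ 2 + ξ 2 ^ 2 - 2 * ξ 0 * ξ 3)) *
    (-1 * ξ 0 ^ 2 + β * (ξ 1 ^ 2 + ξ 2 ^ 2 - 2 * ξ 0 * ξ 3))) (by fun_prop) (fun ξ => ?_) ξ
  simp [gramForm, ctr, shearForm]
  ring

theorem MetaII.doubleCone {R : Matrix (Fin 6) (Fin 6) ℝ} (h : MetaII R) :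
    DoubleCone (tensorOf R) := by
  obtain ⟨α, β, hβ, rfl⟩ := h
  rw [tensorOf_eq_medium]
  have : (!![α, -β, 0, 0, 0, 0; β, α, 0, 0, 0, 0; 0, 0, α, 0, 0, -β; 0, 1, 0, α, β, 0;
      1, 0, 0, -β, α, 0; 0, 0, β, 0, 0, α] : Matrix (Fin 6) (Fin 6) ℝ).submatrix dual id =
      shearForm α β := by
    ext i j
    fin_cases i <;> fin_cases j <;> simp [shearForm, dual]
  rw [this]
  have hs : (shearForm α β).IsSymm := by
    ext i j
    fin_cases i <;> fin_cases j <;> simp [shearForm]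
  refine doubleCone_of_fresnel_eq hβ (isLorentz_shearMetric 1 hβ) (isLorentz_shearMetric (-1) hβ)
    (fun ξ => by rw [fresnel_medium hs, fres_shearForm]) (ξ := ![1, 0, 0, 1 / (2 * β)]) ?_ ?_
  · rw [shearMetric_apply]
    simp
    field_simp
    norm_num
  · rw [shearMetric_apply]
    simp
    field_simp
    norm_num

/-- Classification of skewon-free invertible double-light-cone media into
exactly one of Metaclasses I, II, IV; conversely each normal form has a
double light cone. -/
theorem stmt17 :
    (∀ κ : MT, antisymMT κ → adjT κ = κ → IsUnit (mat6 κ).det → DoubleCone κ →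
      (InClass (mat6 κ) MetaI ∨ InClass (mat6 κ) MetaII ∨ InClass (mat6 κ) MetaIV) ∧
        ¬(InClass (mat6 κ) MetaI ∧ InClass (mat6 κ) MetaII) ∧
        ¬(InClass (mat6 κ) MetaI ∧ InClass (mat6 κ) MetaIV) ∧
        ¬(InClass (mat6 κ) MetaII ∧ InClass (mat6 κ) MetaIV)) ∧
    (∀ R : Matrix (Fin 6) (Fin 6) ℝ, (MetaI R ∨ MetaII R ∨ MetaIV R) →
      DoubleCone (tensorOf R)) := by
  refine ⟨fun κ h h' hd hc => ⟨?_, not_metaI_and_metaII, not_metaI_and_metaIV,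
    not_metaII_and_metaIV⟩, fun R h => ?_⟩
  · have hs := isSymm_of_adjT h h'
    have hκ : mat6 κ = ((mat6 κ).submatrix dual id).submatrix dual id := by
      ext i j
      simp [dual_dual]
    have hd' : ((mat6 κ).submatrix dual id).det ≠ 0 := by
      have e := det_permute (⟨dual, dual, dual_dual, dual_dual⟩ : Equiv.Perm (Fin 6)) (mat6 κ)
      change ((mat6 κ).submatrix dual id).det = _ at e
      rw [e]
      exact mul_ne_zero (by simp) hd.ne_zero
    rw [medium_mat6 h] at hc
    obtain ⟨f, hf, hA⟩ := exists_factored_pull hs hd' hc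
    rw [hκ]
    exact (Classified.of_pull hf hA.classified).inClass
  · rcases h with h | h | h
    · exact h.doubleCone
    · exact h.doubleCone
    · exact h.doubleCone
end
end

section
/- (Isotropic media are not decomposable.) Let g = diag(−1,1,1,1) or g = diag(−1,−1,1,1), let C₁ ∈ ℝ∖{0} and C₂ ∈ ℝ, and let κ = C₁·∗_g + C₂·Id. Then for every pair of nonzero bivectors A and B there exist covectors ξ, α ∈ ℝ⁴ such that ξ∧α ≠ 0, ξ∧κ(ξ∧α) = 0, (ξ∧α)(A) ≠ 0 and (ξ∧α)(B) ≠ 0. (Hence the constant medium κ on ℝ⁴ admits a plane wave whose field 2-form annihilates neither A nor B, so κ is not decomposable.) -/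
noncomputable section
open Matrix BigOperators

/-- Wedge of two covectors: `(ξ∧α)_{ij} = ξ_i α_j − ξ_j α_i`. -/
def wedgeCov (ξ α : Fin 4 → ℝ) : BV := fun i j => ξ i * α j - ξ j * α i

/-- Action of a medium tensor on a 2-form: `(κF)_{ij} = (1/2) κ^{ab}_{ij} F_{ab}`. -/
def actOn (κ : MT) (F : BV) : BV := fun i j => (1 / 2) * ∑ a, ∑ b, κ a b i j * F a b

/-- Pairing of a 2-form with a bivector: `F(A) = (1/2) F_{ij} A^{ij}`. -/
def pairF (F A : BV) : ℝ := (1 / 2) * ∑ i, ∑ j, F i j * A i j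

/-- Two nonzero real polynomials have a common point where neither vanishes. -/
lemma exists_common_nonroot {n : ℕ} {c d : Fin n → ℝ} (hc : c ≠ 0) (hd : d ≠ 0) :
    ∃ t : ℝ, ∑ i, c i * t ^ (i : ℕ) ≠ 0 ∧ ∑ i, d i * t ^ (i : ℕ) ≠ 0 := by
  have key : ∀ e : Fin n → ℝ, e ≠ 0 →
      ∃ p : Polynomial ℝ, p ≠ 0 ∧ ∀ t, p.eval t = ∑ i, e i * t ^ (i : ℕ) := by
    intro e he
    refine ⟨∑ i : Fin n, Polynomial.monomial (i : ℕ) (e i), fun h => he ?_, fun t => ?_⟩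
    · funext j
      simpa [Polynomial.finsetSum_coeff, Polynomial.coeff_monomial, Fin.val_inj] using
        congrArg (fun p => Polynomial.coeff p j) h
    · simp [Polynomial.eval_finsetSum]
  obtain ⟨p, hp, hpe⟩ := key c hc
  obtain ⟨q, hq, hqe⟩ := key d hd
  by_contra! h
  refine mul_ne_zero hp hq (Polynomial.funext fun t => ?_)
  by_cases ht : p.eval t = 0
  · simp [ht]
  · simp [hqe, h t (hpe t ▸ ht)]

lemma hodge_diagonal {s : Fin 4 → ℝ} (hs : ∀ i, s i * s i = 1) (i j k l : Fin 4) :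
    hodge (Matrix.diagonal s) i j k l = s i * s j * eps i j k l := by
  have hinv : (Matrix.diagonal s)⁻¹ = Matrix.diagonal s := by
    refine Matrix.inv_eq_left_inv ?_
    simp [Matrix.diagonal_mul_diagonal, hs]
  have hdet : |(Matrix.diagonal s).det| = 1 := by
    have habs : ∀ i, |s i| = 1 := fun i => by
      rcases mul_self_eq_one_iff.mp (hs i) with h | h <;> simp [h]
    simp [Matrix.det_diagonal, Finset.abs_prod, habs]
  rw [hodge, hdet, hinv]
  simp [Matrix.diagonal_apply]

lemma actOn_isotropic {s : Fin 4 → ℝ} (hs : ∀ i, s i * s i = 1) (C₁ C₂ : ℝ)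
    (ξ α : Fin 4 → ℝ) (k l : Fin 4) :
    actOn (fun i j r s' => C₁ * hodge (Matrix.diagonal s) i j r s' + C₂ * idT i j r s')
        (wedgeCov ξ α) k l =
      C₁ * ((1 / 2) * ∑ a, ∑ b, s a * s b * eps a b k l * wedgeCov ξ α a b) +
        C₂ * wedgeCov ξ α k l := by
  have hid : ∑ a, ∑ b, idT a b k l * wedgeCov ξ α a b = 2 * wedgeCov ξ α k l := by
    simp only [idT, sub_mul, Finset.sum_sub_distrib, ite_mul, mul_ite, one_mul, zero_mul,
      mul_one, mul_zero, Finset.sum_ite_eq', Finset.mem_univ, if_true]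
    simp only [wedgeCov]
    ring
  simp only [actOn, hodge_diagonal hs, add_mul, Finset.sum_add_distrib, mul_assoc,
    ← Finset.mul_sum] at hid ⊢
  rw [hid]
  ring

/-- `ξ ∧ κ(ξ ∧ α)` for an isotropic medium, computed with the metric `diag s`. -/
lemma wedge_actOn_isotropic {s : Fin 4 → ℝ} (hs : ∀ i, s i * s i = 1) (C₁ C₂ : ℝ)
    (ξ α : Fin 4 → ℝ) (i : Fin 4) :
    ∑ j, ∑ k, ∑ l, eps i j k l * ξ j *
        actOn (fun i j r s' => C₁ * hodge (Matrix.diagonal s) i j r s' + C₂ * idT i j r s')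
          (wedgeCov ξ α) k l =
      2 * C₁ * s i * (ξ i * ∑ j, s j * ξ j * α j - α i * ∑ j, s j * ξ j * ξ j) := by
  simp only [actOn_isotropic hs]
  fin_cases i <;>
  · simp [Fin.sum_univ_four, eps, wedgeCov]
    ring

/-- A polynomial family of plane waves whose pairing with each nonzero bivector is a nonzero
polynomial contains a member that annihilates neither of two given nonzero bivectors. -/
lemma exists_wave_of_family {s : Fin 4 → ℝ} (hs : ∀ i, s i * s i = 1) (C₁ C₂ : ℝ) {n : ℕ}
    (ξ α : ℝ → Fin 4 → ℝ) (c : BV → Fin n → ℝ)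
    (hξ : ∀ t, ∑ j, s j * ξ t j * ξ t j = 0) (hξα : ∀ t, ∑ j, s j * ξ t j * α t j = 0)
    (hc : ∀ A, antisymBV A → A ≠ 0 → c A ≠ 0)
    (hpair : ∀ A, antisymBV A → ∀ t,
      pairF (wedgeCov (ξ t) (α t)) A = ∑ i, c A i * t ^ (i : ℕ))
    (A B : BV) (hA : antisymBV A) (hB : antisymBV B) (hA0 : A ≠ 0) (hB0 : B ≠ 0) :
    ∃ ξ αv : Fin 4 → ℝ,
      wedgeCov ξ αv ≠ 0 ∧
      (∀ i, ∑ j, ∑ k, ∑ l, eps i j k l * ξ j *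
        actOn (fun i' j' r s' => C₁ * hodge (Matrix.diagonal s) i' j' r s' + C₂ * idT i' j' r s')
          (wedgeCov ξ αv) k l = 0) ∧
      pairF (wedgeCov ξ αv) A ≠ 0 ∧ pairF (wedgeCov ξ αv) B ≠ 0 := by
  obtain ⟨t, htA, htB⟩ := exists_common_nonroot (hc A hA hA0) (hc B hB hB0)
  rw [← hpair A hA] at htA
  rw [← hpair B hB] at htB
  refine ⟨ξ t, α t, fun h => htA ?_, fun i => ?_, htA, htB⟩
  · simp [h, pairF]
  · rw [wedge_actOn_isotropic hs, hξ, hξα]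
    ring

lemma antisymBV.pairF_eq {A : BV} (hA : antisymBV A) (ξ α : Fin 4 → ℝ) :
    pairF (wedgeCov ξ α) A =
      wedgeCov ξ α 0 1 * A 0 1 + wedgeCov ξ α 0 2 * A 0 2 + wedgeCov ξ α 0 3 * A 0 3 +
        wedgeCov ξ α 1 2 * A 1 2 + wedgeCov ξ α 1 3 * A 1 3 + wedgeCov ξ α 2 3 * A 2 3 := by
  simp only [pairF, wedgeCov, Fin.sum_univ_four, hA 1 0, hA 2 0, hA 3 0, hA 2 1, hA 3 1, hA 3 2]
  ring

lemma antisymBV.eq_zero {A : BV} (hA : antisymBV A) (h01 : A 0 1 = 0) (h02 : A 0 2 = 0)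
    (h03 : A 0 3 = 0) (h12 : A 1 2 = 0) (h13 : A 1 3 = 0) (h23 : A 2 3 = 0) : A = 0 := by
  have hdiag : ∀ i, A i i = 0 := fun i => by linarith [hA i i]
  funext i j
  fin_cases i <;> fin_cases j <;>
    simp [hdiag, hA 1 0, hA 2 0, hA 3 0, hA 2 1, hA 3 1, hA 3 2, h01, h02, h03, h12, h13, h23]

/-- Isotropic media are not decomposable: for κ = C₁·∗_g + C₂·Id with
g = diag(−1,1,1,1) or diag(−1,−1,1,1) and any nonzero bivectors A, B there is
a plane-wave covector datum (ξ, α) with ξ∧α ≠ 0, ξ∧κ(ξ∧α) = 0,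
(ξ∧α)(A) ≠ 0 and (ξ∧α)(B) ≠ 0. -/
theorem stmt19 (g : Matrix (Fin 4) (Fin 4) ℝ)
    (hg : g = Matrix.diagonal ![-1, 1, 1, 1] ∨ g = Matrix.diagonal ![-1, -1, 1, 1])
    (C₁ C₂ : ℝ) (hC₁ : C₁ ≠ 0)
    (A B : BV) (hA : antisymBV A) (hB : antisymBV B) (hA0 : A ≠ 0) (hB0 : B ≠ 0) :
    ∃ ξ αv : Fin 4 → ℝ,
      wedgeCov ξ αv ≠ 0 ∧
      (∀ i, ∑ j, ∑ k, ∑ l, eps i j k l * ξ j *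
        actOn (fun i' j' r s => C₁ * hodge g i' j' r s + C₂ * idT i' j' r s)
          (wedgeCov ξ αv) k l = 0) ∧
      pairF (wedgeCov ξ αv) A ≠ 0 ∧ pairF (wedgeCov ξ αv) B ≠ 0 := by
  rcases hg with rfl | rfl
  · refine exists_wave_of_family (s := ![-1, 1, 1, 1]) (fun i => by fin_cases i <;> simp)
      C₁ C₂ (fun t => ![1 + t ^ 2, 2 * t, 0, t ^ 2 - 1]) (fun t => ![t, 1, t ^ 3, t])
      (fun A => ![A 0 1 + A 1 3, 2 * A 0 3, -A 0 1 + A 1 3,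
        A 0 2 + A 2 3, 2 * A 1 2, A 0 2 - A 2 3])
      (fun t => ?_) (fun t => ?_) (fun A hA hA0 hc => hA0 ?_) (fun A hA t => ?_)
      A B hA hB hA0 hB0
    · simp [Fin.sum_univ_four]
      ring
    · simp [Fin.sum_univ_four]
      ring
    · have h (i) := congrFun hc i
      simp only [Fin.forall_fin_succ] at h
      simp at h
      obtain ⟨h0, h1, h2, h3, h4, h5⟩ := h
      apply hA.eq_zero <;> linarith
    · rw [hA.pairF_eq]
      simp [wedgeCov, Fin.sum_univ_six]
      ring
  · refine exists_wave_of_family (s := ![-1, -1, 1, 1]) (fun i => by fin_cases i <;> simp)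
      C₁ C₂ (fun t => ![1 - t ^ 2, 2 * t, 1 + t ^ 2, 0])
      (fun t => ![-(t ^ 4 + t), 1 + t ^ 3, t ^ 4 + t, 1 - t ^ 3])
      (fun A => ![A 0 1 + A 0 3 - A 1 2 + A 2 3, 2 * A 0 2 + 2 * A 1 3,
        A 0 1 - A 0 3 + A 1 2 + A 2 3, A 0 1 - A 0 3 - A 1 2 - A 2 3,
        2 * A 0 2 - 2 * A 1 3, A 0 1 + A 0 3 + A 1 2 - A 2 3])
      (fun t => ?_) (fun t => ?_) (fun A hA hA0 hc => hA0 ?_) (fun A hA t => ?_)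
      A B hA hB hA0 hB0
    · simp [Fin.sum_univ_four]
      ring
    · simp [Fin.sum_univ_four]
      ring
    · have h (i) := congrFun hc i
      simp only [Fin.forall_fin_succ] at h
      simp at h
      obtain ⟨h0, h1, h2, h3, h4, h5⟩ := h
      apply hA.eq_zero <;> linarith
    · rw [hA.pairF_eq]
      simp [wedgeCov, Fin.sum_univ_six]
      ring
end
end
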